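/- arXiv:2004.07912 — 3 statements merged into one kernel-verified Lean document; each statement's English description precedes it below -/
import Mathlib

section
/- Let T be a metric tree, let x,y,z ∈ T be branch points of T, and let c be the center of x,y,z, i.e., {c} = [x,y]∩[y,z]∩[z,x]. Then c is a branch point of T and H_T(c) ≥ min{H_T(x), H_T(y), H_T(z)}. -/
/-- `A` is a (possibly degenerate) arc in `X` with endpoints `x` and `y`. -/
def IsArc {X : Type*} [TopologicalSpace X] (A : Set X) (x y : X) : Prop :=
  (x = y ∧ A = {x}) ∨
  (x ≠ y ∧ ∃ f : ℝ → X, ContinuousOn f (Set.Icc 0 1) ∧ Set.InjOn f (Set.Icc 0 1) ∧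
    f 0 = x ∧ f 1 = y ∧ A = f '' Set.Icc 0 1)

/-- A metric tree: a compact, connected, locally connected metric space with at
least two points in which any two points are joined by a unique arc. -/
structure IsMetricTree (T : Type*) [MetricSpace T] : Prop where
  compact : CompactSpace T
  conn : ConnectedSpace T
  locConn : LocallyConnectedSpace T
  nontriv : Nontrivial T
  arcUnique : ∀ x y : T, ∃! A : Set T, IsArc A x y

/-- The unique arc `[x,y]` joining `x` and `y` in the metric tree `T`. -/
noncomputable def treeArc {T : Type*} [MetricSpace T] (h : IsMetricTree T) (x y : T) :
    Set T :=
  (h.arcUnique x y).choose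

/-- `B` is a branch of `p` in the subset `S`, i.e., the closure of a connected
component of `S \ {p}`. -/
def IsBranchIn {X : Type*} [TopologicalSpace X] (S : Set X) (p : X) (B : Set X) : Prop :=
  ∃ q ∈ S \ {p}, B = closure (connectedComponentIn (S \ {p}) q)

/-- `B` is a branch of `p` in the whole space, i.e., the closure of a connected
component of the complement of `{p}`. -/
def IsBranch {X : Type*} [TopologicalSpace X] (p : X) (B : Set X) : Prop :=
  IsBranchIn Set.univ p B

/-- `p` is a branch point of the subset `S`: `p` has at least three distinct
branches in `S`. -/
def IsBranchPointIn {X : Type*} [TopologicalSpace X] (S : Set X) (p : X) : Prop :=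
  ∃ B₁ B₂ B₃ : Set X, IsBranchIn S p B₁ ∧ IsBranchIn S p B₂ ∧ IsBranchIn S p B₃ ∧
    B₁ ≠ B₂ ∧ B₁ ≠ B₃ ∧ B₂ ≠ B₃

/-- `p` is a branch point: `p` has at least three distinct branches. -/
def IsBranchPoint {X : Type*} [TopologicalSpace X] (p : X) : Prop :=
  IsBranchPointIn Set.univ p

/-- The height `H_S(p)` of `p` in the subset `S`: the diameter of the third
largest branch of `p` in `S`, realized as the supremum of
`min (diam B₁) (min (diam B₂) (diam B₃))` over triples of distinct branches. -/
noncomputable def heightIn {X : Type*} [MetricSpace X] (S : Set X) (p : X) : ℝ :=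
  sSup {r : ℝ | ∃ B₁ B₂ B₃ : Set X, IsBranchIn S p B₁ ∧ IsBranchIn S p B₂ ∧
    IsBranchIn S p B₃ ∧ B₁ ≠ B₂ ∧ B₁ ≠ B₃ ∧ B₂ ≠ B₃ ∧
    r = min (Metric.diam B₁) (min (Metric.diam B₂) (Metric.diam B₃))}

/-- The height `H_T(p)` of `p` in the whole tree. -/
noncomputable def treeHeight {X : Type*} [MetricSpace X] (p : X) : ℝ :=
  heightIn Set.univ p

/-- A subtree of a metric tree: a closed connected subset with at least
two points. -/
def IsSubtree {X : Type*} [TopologicalSpace X] (S : Set X) : Prop :=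
  IsClosed S ∧ IsConnected S ∧ S.Nontrivial

/-- A possibly discontinuous curve from `p` to `q`, parametrised by `[0, 1]`, all of whose jumps
are smaller than `δ`, uniformly at parameter distance `η`. -/
structure IsCoarsePath {X : Type*} [PseudoMetricSpace X] (η δ : ℝ) (p q : X) (g : ℝ → X) :
    Prop where
  source : ∀ t ≤ 0, g t = p
  target : ∀ t, 1 ≤ t → g t = q
  dist_lt : ∀ s t, |s - t| < η → dist (g s) (g t) < δ

namespace IsCoarsePath

variable {X : Type*} [PseudoMetricSpace X] {η δ : ℝ} {p q r : X} {g : ℝ → X}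

theorem of_lt (h : ∀ s t, s ≤ t → t - s < η → dist (g s) (g t) < δ)
    (h₀ : ∀ t ≤ 0, g t = p) (h₁ : ∀ t, 1 ≤ t → g t = q) : IsCoarsePath η δ p q g where
  source := h₀
  target := h₁
  dist_lt s t hst := by
    rcases le_total s t with hle | hle
    · exact h s t hle (by rw [abs_sub_comm] at hst; exact (le_abs_self _).trans_lt hst)
    · rw [dist_comm]
      exact h t s hle ((le_abs_self _).trans_lt hst)

theorem const (hδ : 0 < δ) (p : X) : IsCoarsePath η δ p p fun _ => p :=
  ⟨fun _ _ => rfl, fun _ _ => rfl, fun _ _ _ => by simpa using hδ⟩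

theorem step (h : dist p q < δ) : IsCoarsePath η δ p q fun t => if t ≤ 0 then p else q := by
  have hδ : 0 < δ := dist_nonneg.trans_lt h
  refine ⟨fun t ht => if_pos ht, fun t ht => if_neg (by linarith), fun s t _ => ?_⟩
  split_ifs <;> simp [hδ, h, dist_comm q p]

theorem mono {η' : ℝ} (h : IsCoarsePath η δ p q g) (hη : η' ≤ η) : IsCoarsePath η' δ p q g :=
  ⟨h.source, h.target, fun s t hst => h.dist_lt s t (hst.trans_le hη)⟩

/-- Concatenation, with a pause at the middle point so that jumps do not add up. -/
theorem trans {g' : ℝ → X} (h : IsCoarsePath η δ p q g) (h' : IsCoarsePath η δ q r g') :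
    IsCoarsePath (min (η / 3) (1 / 6)) δ p r
      fun t => if t ≤ 1 / 2 then g (3 * t) else g' (3 * t - 2) := by
  refine of_lt (fun s t hst hlt => ?_) (fun t ht => ?_) (fun t ht => ?_)
  · have h₁ := hlt.trans_le (min_le_left _ _)
    have h₂ := hlt.trans_le (min_le_right _ _)
    have key : |3 * s - 3 * t| < η := by rw [abs_sub_comm, abs_of_nonneg] <;> linarith
    have key' : |(3 * s - 2) - (3 * t - 2)| < η := by
      rw [abs_sub_comm, abs_of_nonneg] <;> linarith
    split_ifs with hs ht ht
    · exact h.dist_lt _ _ key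
    · rcases le_total (1 / 3) s with hs' | hs'
      · rw [h.target _ (by linarith), ← h'.source (3 * s - 2) (by linarith)]
        exact h'.dist_lt _ _ key'
      · rw [h'.source _ (by linarith), ← h.target (3 * t) (by linarith)]
        exact h.dist_lt _ _ key
    · linarith
    · exact h'.dist_lt _ _ key'
  · rw [if_pos (by linarith)]
    exact h.source _ (by linarith)
  · rw [if_neg (by linarith)]
    exact h'.target _ (by linarith)

end IsCoarsePath

/-- Points of a preconnected set are joined inside it by curves with arbitrarily small jumps. -/
theorem IsPreconnected.exists_isCoarsePath {X : Type*} [PseudoMetricSpace X] {C : Set X}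
    (hC : IsPreconnected C) {δ : ℝ} (hδ : 0 < δ) {p q : X} (hp : p ∈ C) (hq : q ∈ C) :
    ∃ η > 0, ∃ g, IsCoarsePath η δ p q g ∧ ∀ t, g t ∈ C := by
  have aux : ∀ a ∈ C, ∀ b ∈ C, dist a b < δ →
      ∃ η > 0, ∃ g, IsCoarsePath η δ a b g ∧ ∀ t, g t ∈ C := fun a ha b hb hab =>
    ⟨1, one_pos, _, IsCoarsePath.step hab, fun t => by split_ifs <;> assumption⟩
  refine hC.induction₂' (fun a b => ∃ η > 0, ∃ g, IsCoarsePath η δ a b g ∧ ∀ t, g t ∈ C)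
    (fun a ha => ?_) (fun a b c ha hb hc => ?_) hp hq
  · filter_upwards [self_mem_nhdsWithin, nhdsWithin_le_nhds (Metric.ball_mem_nhds a hδ)]
      with b hb hab
    rw [Metric.mem_ball] at hab
    exact ⟨aux a ha b hb (dist_comm b a ▸ hab), aux b hb a ha hab⟩
  · rintro ⟨η, hη, g, hg, hgC⟩ ⟨η', hη', g', hg', hgC'⟩
    refine ⟨_, ?_, _, (hg.mono (min_le_left η η')).trans (hg'.mono (min_le_right η η')),
      fun t => ?_⟩
    · positivity
    · split_ifs
      exacts [hgC _, hgC' _]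

/-- If points at distance less than `δ` lie in a common preconnected set of size `ε`, a curve with
jumps less than `δ` can be approximated by curves with arbitrarily small jumps. -/
theorem IsCoarsePath.exists_refinement {X : Type*} [PseudoMetricSpace X] {η δ ε δ' : ℝ}
    {p q : X} {g : ℝ → X} (hg : IsCoarsePath η δ p q g) (hη : 0 < η) (hδ' : 0 < δ')
    (hC : ∀ a b : X, dist a b < δ →
      ∃ C : Set X, IsPreconnected C ∧ a ∈ C ∧ b ∈ C ∧ C ⊆ Metric.ball a ε) :
    ∃ η' > 0, ∃ g', IsCoarsePath η' δ' p q g' ∧ ∀ t, dist (g t) (g' t) < δ + ε := by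
  obtain ⟨n, hn⟩ := exists_nat_one_div_lt hη
  obtain ⟨N, hN⟩ : ∃ N : ℝ, N = n + 1 := ⟨_, rfl⟩
  rw [← hN] at hn
  have hN0 : 0 < N := by rw [hN]; positivity
  have hstep (i : ℤ) : dist (g (i / N)) (g ((i + 1 : ℤ) / N)) < δ := by
    refine hg.dist_lt _ _ ?_
    rwa [← sub_div, Int.cast_add, Int.cast_one, sub_add_cancel_left, abs_div, abs_neg, abs_one,
      abs_of_pos hN0]
  have hpiece (i : ℤ) : ∃ c : ℝ → X, ∃ ξ > 0,
      IsCoarsePath ξ (δ' / 2) (g (i / N)) (g ((i + 1 : ℤ) / N)) c ∧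
      (∀ t, dist (g (i / N)) (c t) < ε) ∧
      (i ∉ Finset.Ico (0 : ℤ) (n + 1) → ξ = 1 ∧ ∀ t, c t = g (i / N)) := by
    obtain ⟨C, hCc, ha, hb, hCε⟩ := hC _ _ (hstep i)
    by_cases hi : i ∈ Finset.Ico (0 : ℤ) (n + 1)
    · obtain ⟨ξ, hξ, c, hc, hcC⟩ := hCc.exists_isCoarsePath (half_pos hδ') ha hb
      exact ⟨c, ξ, hξ, hc, fun t => by simpa [dist_comm] using hCε (hcC t), fun h => (h hi).elim⟩
    · have heq : g ((i + 1 : ℤ) / N) = g (i / N) := by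
        rw [Finset.mem_Ico, not_and_or, not_le, not_lt] at hi
        rcases hi with hi | hi
        · have h1 : ((i + 1 : ℤ) : ℝ) ≤ 0 := by exact_mod_cast hi
          have h2 : (i : ℝ) ≤ 0 := by exact_mod_cast hi.le
          rw [hg.source _ (div_nonpos_of_nonpos_of_nonneg h1 hN0.le),
            hg.source _ (div_nonpos_of_nonpos_of_nonneg h2 hN0.le)]
        · have h2 : N ≤ (i : ℝ) := by rw [hN]; exact_mod_cast hi
          rw [hg.target _ ((one_le_div hN0).2 h2), hg.target]
          rw [one_le_div hN0]
          push_cast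
          linarith
      refine ⟨fun _ => g (i / N), 1, one_pos, ?_, fun t => by simpa [dist_comm] using hCε ha,
        fun _ => ⟨rfl, fun _ => rfl⟩⟩
      rw [heq]
      exact IsCoarsePath.const (half_pos hδ') _
  choose c ξ hξ hc hcε hconst using hpiece
  obtain ⟨ξ₀, hξ₀, hξ₁, hle⟩ : ∃ ξ₀ > 0, ξ₀ ≤ 1 ∧ ∀ i, ξ₀ ≤ ξ i := by
    refine ⟨min 1 ((Finset.Ico (0 : ℤ) (n + 1)).inf' (Finset.nonempty_Ico.2 (by positivity)) ξ), ?_,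
      min_le_left _ _, fun i => ?_⟩
    · rw [gt_iff_lt, lt_min_iff, Finset.lt_inf'_iff]
      exact ⟨one_pos, fun i _ => hξ i⟩
    · by_cases hi : i ∈ Finset.Ico (0 : ℤ) (n + 1)
      · exact (min_le_right _ _).trans (Finset.inf'_le _ hi)
      · rw [(hconst i hi).1]
        exact min_le_left _ _
  refine ⟨ξ₀ / N, by positivity, fun t => c ⌊N * t⌋ (N * t - ⌊N * t⌋),
    IsCoarsePath.of_lt (fun s t hst hlt => ?_) (fun t ht => ?_) (fun t ht => ?_), fun t => ?_⟩
  · rw [lt_div_iff₀ hN0] at hlt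
    have hst' : N * s ≤ N * t := by gcongr
    have hs₁ := Int.floor_le (N * s)
    have ht₁ := Int.floor_le (N * t)
    have hs₂ := Int.lt_floor_add_one (N * s)
    have ht₂ := Int.lt_floor_add_one (N * t)
    have hfl : ⌊N * t⌋ = ⌊N * s⌋ ∨ ⌊N * t⌋ = ⌊N * s⌋ + 1 := by
      have h1 := Int.floor_le_floor hst'
      have h2 : ⌊N * t⌋ < ⌊N * s⌋ + 2 := by
        rw [Int.floor_lt]; push_cast; linarith
      lia
    rcases hfl with h | h
    · rw [h]
      refine ((hc _).dist_lt _ _ ?_).trans (half_lt_self hδ')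
      refine lt_of_lt_of_le ?_ (hle _)
      rw [abs_sub_comm, abs_of_nonneg] <;> linarith
    · rw [h] at ht₁ ⊢
      push_cast at ht₁ ⊢
      have h1 : dist (c ⌊N * s⌋ (N * s - ⌊N * s⌋)) (c ⌊N * s⌋ 1) < δ' / 2 := by
        refine (hc _).dist_lt _ _ (lt_of_lt_of_le ?_ (hle _))
        rw [abs_sub_comm, abs_of_nonneg] <;> linarith
      have h2 : dist (c (⌊N * s⌋ + 1) 0) (c (⌊N * s⌋ + 1) (N * t - (⌊N * s⌋ + 1))) < δ' / 2 := by
        refine (hc _).dist_lt _ _ (lt_of_lt_of_le ?_ (hle _))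
        rw [abs_sub_comm, abs_of_nonneg] <;> linarith
      rw [(hc _).source 0 le_rfl, ← (hc _).target 1 le_rfl] at h2
      linarith [dist_triangle (c ⌊N * s⌋ (N * s - ⌊N * s⌋)) (c ⌊N * s⌋ 1)
        (c (⌊N * s⌋ + 1) (N * t - (⌊N * s⌋ + 1)))]
  · rcases ht.eq_or_lt with rfl | ht
    · simp only [mul_zero, Int.floor_zero, Int.cast_zero, sub_zero]
      rw [(hc 0).source 0 le_rfl, hg.source _ (by simp)]
    · have h : ⌊N * t⌋ < 0 := Int.floor_lt.2 (by simpa using mul_neg_of_pos_of_neg hN0 ht)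
      have h' : ((⌊N * t⌋ : ℤ) : ℝ) ≤ 0 := by exact_mod_cast h.le
      rw [(hconst _ (by simp [h])).2, hg.source _ (div_nonpos_of_nonpos_of_nonneg h' hN0.le)]
  · have h : (n + 1 : ℤ) ≤ ⌊N * t⌋ := Int.le_floor.2 (by push_cast; nlinarith)
    have h' : N ≤ (⌊N * t⌋ : ℤ) := by
      have h'' : ((n + 1 : ℤ) : ℝ) ≤ (⌊N * t⌋ : ℤ) := Int.cast_le.2 h
      push_cast at h''
      rwa [← hN] at h''
    rw [(hconst _ (by rw [Finset.mem_Ico]; lia)).2, hg.target _ ((one_le_div hN0).2 h')]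
  · have h1 : dist (g t) (g (⌊N * t⌋ / N)) < δ := by
      refine hg.dist_lt _ _ (lt_trans ?_ hn)
      have ht₁ := Int.floor_le (N * t)
      have ht₂ := Int.lt_floor_add_one (N * t)
      have : t - ⌊N * t⌋ / N = (N * t - ⌊N * t⌋) / N := by field_simp
      rw [this, abs_of_nonneg (div_nonneg (by linarith) hN0.le)]
      exact (div_lt_div_iff_of_pos_right hN0).2 (by linarith)
    linarith [dist_triangle (g t) (g (⌊N * t⌋ / N)) (c ⌊N * t⌋ (N * t - ⌊N * t⌋)),
      hcε ⌊N * t⌋ (N * t - ⌊N * t⌋)]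

open Filter Topology in
/-- In a complete space, uniform local connectedness implies uniform local path connectedness. -/
theorem exists_continuous_small_curve {X : Type*} [MetricSpace X] [CompleteSpace X]
    (hC : ∀ ε > 0, ∃ δ > 0, ∀ a b : X, dist a b < δ →
      ∃ C : Set X, IsPreconnected C ∧ a ∈ C ∧ b ∈ C ∧ C ⊆ Metric.ball a ε)
    {ε : ℝ} (hε : 0 < ε) :
    ∃ δ > 0, ∀ p q : X, dist p q < δ →
      ∃ f : ℝ → X, Continuous f ∧ f 0 = p ∧ f 1 = q ∧ ∀ t, dist (f t) p < ε := by
  set e : ℕ → ℝ := fun n => ε / 6 / 2 ^ n with he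
  have he0 (n : ℕ) : 0 < e n := by positivity
  have hδ (n : ℕ) : ∃ δ > 0, δ ≤ e n ∧ ∀ a b : X, dist a b < δ →
      ∃ C : Set X, IsPreconnected C ∧ a ∈ C ∧ b ∈ C ∧ C ⊆ Metric.ball a (e n) := by
    obtain ⟨δ, hδ, h⟩ := hC (e n) (he0 n)
    exact ⟨min δ (e n), lt_min hδ (he0 n), min_le_right _ _,
      fun a b hab => h a b (hab.trans_le (min_le_left _ _))⟩
  choose δ hδ0 hδe hδC using hδ
  refine ⟨δ 0, hδ0 0, fun p q hpq => ?_⟩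
  let S (n : ℕ) := {g : ℝ → X // ∃ η > 0, IsCoarsePath η (δ n) p q g}
  have hnext (n : ℕ) (g : S n) : ∃ g' : S (n + 1), ∀ t, dist (g.1 t) (g'.1 t) < δ n + e n := by
    obtain ⟨g, η, hη, hg⟩ := g
    obtain ⟨η', hη', g', hg', hd⟩ := hg.exists_refinement hη (hδ0 (n + 1)) (hδC n)
    exact ⟨⟨g', η', hη', hg'⟩, hd⟩
  choose next hnext using hnext
  let g₀ : S 0 := ⟨fun t => if t ≤ 0 then p else q, 1, one_pos, IsCoarsePath.step hpq⟩
  let G (n : ℕ) : S n := Nat.rec g₀ next n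
  have hG (t : ℝ) (n : ℕ) : dist ((G n).1 t) ((G (n + 1)).1 t) ≤ 2 * ε / 3 / 2 / 2 ^ n := by
    have h : 2 * ε / 3 / 2 / 2 ^ n = e n + e n := by rw [he]; ring
    rw [h]
    exact (hnext n (G n) t).le.trans (by linarith [hδe n])
  have hlim (t : ℝ) : ∃ y, Tendsto (fun n => (G n).1 t) atTop (𝓝 y) :=
    cauchySeq_tendsto_of_complete (cauchySeq_of_le_geometric_two (hG t))
  choose f hf using hlim
  have hfd (t : ℝ) (n : ℕ) : dist ((G n).1 t) (f t) ≤ 4 * e n := by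
    have h : 4 * e n = 2 * ε / 3 / 2 ^ n := by rw [he]; ring
    rw [h]
    exact dist_le_of_le_geometric_two_of_tendsto (hG t) (hf t) n
  have hends (t : ℝ) (y : X) (h : ∀ n, (G n).1 t = y) : f t = y :=
    tendsto_nhds_unique (hf t) (by simp only [h, tendsto_const_nhds])
  refine ⟨f, Metric.continuous_iff.2 fun s r hr => ?_, hends 0 p fun n => ?_,
    hends 1 q fun n => ?_, fun t => ?_⟩
  · have he_lim : Tendsto e atTop (𝓝 0) := by
      have := (tendsto_pow_atTop_nhds_zero_of_lt_one (r := (2 : ℝ)⁻¹) (by norm_num)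
        (by norm_num)).const_mul (ε / 6)
      simpa [he, div_eq_mul_inv] using this
    obtain ⟨n, hn⟩ := (he_lim.eventually (gt_mem_nhds (show 0 < r / 9 by positivity))).exists
    obtain ⟨η, hη, h⟩ := (G n).2
    refine ⟨η, hη, fun t hts => ?_⟩
    have h1 := h.dist_lt t s hts
    have h2 := hfd t n
    have h3 := hfd s n
    rw [dist_comm] at h2
    linarith [dist_triangle4 (f t) ((G n).1 t) ((G n).1 s) (f s), hδe n]
  · obtain ⟨η, -, h⟩ := (G n).2
    exact h.source 0 le_rfl
  · obtain ⟨η, -, h⟩ := (G n).2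
    exact h.target 1 le_rfl
  · have h1 : dist ((G 0).1 t) p < δ 0 := by
      change dist (if t ≤ 0 then p else q) p < δ 0
      split_ifs
      · simpa using hδ0 0
      · rwa [dist_comm]
    have h2 := hfd t 0
    have h3 : e 0 = ε / 6 := by simp [he]
    rw [dist_comm] at h2
    linarith [dist_triangle (f t) ((G 0).1 t) p, hδe 0]

/-- A compact locally connected metric space is locally path connected. -/
theorem LocallyPathConnectedSpace.of_compact_locallyConnected (X : Type*) [MetricSpace X]
    [CompactSpace X] [LocallyConnectedSpace X] : LocallyPathConnectedSpace X := by
  have hC : ∀ ε > 0, ∃ δ > 0, ∀ a b : X, dist a b < δ →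
      ∃ C : Set X, IsPreconnected C ∧ a ∈ C ∧ b ∈ C ∧ C ⊆ Metric.ball a ε := by
    intro ε hε
    have hV (x : X) : ∃ V ⊆ Metric.ball x (ε / 2), IsOpen V ∧ x ∈ V ∧ IsConnected V :=
      locallyConnectedSpace_iff_subsets_isOpen_isConnected.1 ‹_› x _
        (Metric.ball_mem_nhds x (half_pos hε))
    choose V hVb hVo hxV hVc using hV
    obtain ⟨δ, hδ, h⟩ := lebesgue_number_lemma_of_metric (isCompact_univ (X := X)) hVo
      fun x _ => Set.mem_iUnion.2 ⟨x, hxV x⟩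
    refine ⟨δ, hδ, fun a b hab => ?_⟩
    obtain ⟨x, hx⟩ := h a trivial
    have ha : a ∈ V x := hx (Metric.mem_ball_self hδ)
    refine ⟨V x, (hVc x).isPreconnected, ha, hx (by rwa [Metric.mem_ball, dist_comm]),
      fun y hy => ?_⟩
    have h1 := hVb x ha
    have h2 := hVb x hy
    rw [Metric.mem_ball] at *
    linarith [dist_triangle_right y a x]
  refine LocallyPathConnectedSpace.of_bases
    (p := fun x s => ∃ ε > 0, s = pathComponentIn (Metric.ball x ε) x) (s := fun _ s => s)
    (fun x => ⟨fun t => ?_⟩) ?_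
  · have hmem {ε : ℝ} (hε : 0 < ε) : pathComponentIn (Metric.ball x ε) x ∈ nhds x := by
      obtain ⟨δ, hδ, h⟩ := exists_continuous_small_curve hC hε
      filter_upwards [Metric.ball_mem_nhds x hδ] with y hy
      obtain ⟨f, hf, h0, h1, hfx⟩ := h x y (by rwa [dist_comm])
      exact JoinedIn.ofLine hf.continuousOn h0 h1 (by rintro _ ⟨t, -, rfl⟩; exact hfx t)
    constructor
    · intro ht
      obtain ⟨ε, hε, hεt⟩ := Metric.mem_nhds_iff.1 ht
      exact ⟨_, ⟨ε, hε, rfl⟩, pathComponentIn_subset.trans hεt⟩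
    · rintro ⟨_, ⟨ε, hε, rfl⟩, h⟩
      exact Filter.mem_of_superset (hmem hε) h
  · rintro x _ ⟨ε, hε, rfl⟩
    exact isPathConnected_pathComponentIn (Metric.mem_ball_self hε)

/-- A continuous curve `g` on `[0, 1]` whose fibres are intervals is, after reparametrisation,
injective. -/
theorem exists_injective_reparam {X : Type*} [MetricSpace X] (g : C(unitInterval, X))
    (hne : g 0 ≠ g 1)
    (hg : ∀ s t, s < t → g s = g t → ∀ u ∈ Set.Icc s t, g u = g s) :
    ∃ f : C(unitInterval, X), Function.Injective f ∧ f 0 = g 0 ∧ f 1 = g 1 ∧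
      Set.range f ⊆ Set.range g := by
  let k (a t s : unitInterval) : ℝ := min 1 (dist (g (a ⊔ (s ⊓ t))) (g a))
  let h (a t : unitInterval) : ℝ := sSup (k a t '' Set.univ)
  have hk0 (a t s) : 0 ≤ k a t s := le_min zero_le_one dist_nonneg
  have hbdd (a t) : BddAbove (k a t '' Set.univ) :=
    ⟨1, by rintro _ ⟨s, -, rfl⟩; exact min_le_left _ _⟩
  have hkh (a t s) : k a t s ≤ h a t := le_csSup (hbdd a t) ⟨s, trivial, rfl⟩
  have hh0 (a t) : 0 ≤ h a t := (hk0 a t 0).trans (hkh a t 0)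
  have hh1 (a t) : h a t ≤ 1 := csSup_le (Set.univ_nonempty.image _) (by
    rintro _ ⟨s, -, rfl⟩; exact min_le_left _ _)
  have hhc (a) : Continuous (h a) := by
    refine isCompact_univ.continuous_sSup ?_
    change Continuous fun x : unitInterval × unitInterval => k a x.1 x.2
    fun_prop
  have hhm (a) : Monotone (h a) := by
    intro t t' htt'
    refine csSup_le (Set.univ_nonempty.image _) ?_
    rintro _ ⟨s, -, rfl⟩
    have : k a t s = k a t' (s ⊓ t) := by
      simp only [k, inf_assoc, inf_eq_left.2 htt']
    rw [this]
    exact hkh _ _ _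
  have hzero {a t} (hta : t ≤ a) : h a t = 0 := by
    have hk' (s) : k a t s = 0 := by
      simp only [k, sup_eq_left.2 (inf_le_right.trans hta), dist_self]
      simp
    refine le_antisymm (csSup_le (Set.univ_nonempty.image _) ?_) (hh0 a t)
    rintro _ ⟨s, -, rfl⟩
    exact (hk' s).le
  have hconst {s t} (hst : s < t) (hgst : g s = g t) (a) : h a s = h a t := by
    have hgc (u) (hu : u ∈ Set.Icc s t) (v) (hv : v ∈ Set.Icc s t) : g u = g v :=
      (hg s t hst hgst u hu).trans (hg s t hst hgst v hv).symm
    have : k a s = k a t := by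
      funext u
      simp only [k]
      congr 2
      rcases le_total u s with hu | hu
      · rw [inf_eq_left.2 hu, inf_eq_left.2 (hu.trans hst.le)]
      · rw [inf_eq_right.2 hu]
        rcases le_total t a with ha | ha
        · rw [sup_eq_left.2 (hst.le.trans ha), sup_eq_left.2 (inf_le_right.trans ha)]
        · exact hgc _ ⟨le_sup_right, sup_le ha hst.le⟩ _
            ⟨(le_inf hu hst.le).trans le_sup_right, sup_le ha inf_le_right⟩
    simp only [h, this]
  let d := TopologicalSpace.denseSeq unitInterval
  have hlt {s t} (hst : s < t) (hgst : g s ≠ g t) : ∃ n, h (d n) s < h (d n) t := by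
    have hW : IsOpen ({u | g u ≠ g t} ∩ Set.Ioo s t) :=
      (isOpen_ne_fun g.continuous continuous_const).inter isOpen_Ioo
    have hWne : ({u | g u ≠ g t} ∩ Set.Ioo s t).Nonempty := by
      have : (nhdsWithin s (Set.Ioi s)).NeBot := nhdsGT_neBot_of_exists_gt ⟨t, hst⟩
      have h1 : ∀ᶠ u in nhdsWithin s (Set.Ioi s), g u ≠ g t := nhdsWithin_le_nhds
        ((isOpen_ne_fun g.continuous continuous_const).mem_nhds hgst)
      exact (h1.and (Ioo_mem_nhdsGT hst)).exists
    obtain ⟨n, hne', hs, ht⟩ :=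
      (TopologicalSpace.denseRange_denseSeq unitInterval).exists_mem_open hW hWne
    refine ⟨n, ?_⟩
    rw [hzero hs.le]
    refine lt_of_lt_of_le (lt_min one_pos (dist_pos.2 (Ne.symm hne'))) ?_
    have := hkh (d n) t t
    simp only [k, inf_idem, sup_eq_right.2 (show d n ≤ t from ht.le)] at this
    exact this
  let φ (t : unitInterval) : ℝ := ∑' n, (1 / 2) ^ n * h (d n) t
  have hbound (n t) : ‖(1 / 2 : ℝ) ^ n * h (d n) t‖ ≤ (1 / 2) ^ n := by
    rw [Real.norm_of_nonneg (mul_nonneg (by positivity) (hh0 _ _))]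
    exact mul_le_of_le_one_right (by positivity) (hh1 _ _)
  have hφc : Continuous φ :=
    continuous_tsum (fun n => continuous_const.mul (hhc _)) summable_geometric_two hbound
  have hsum (t) : Summable fun n => (1 / 2 : ℝ) ^ n * h (d n) t :=
    summable_geometric_two.of_norm_bounded fun n => hbound n t
  have hφ0 : φ 0 = 0 := by
    simp only [φ, hzero unitInterval.nonneg', mul_zero, tsum_zero]
  have hφm : Monotone φ := fun s t hst => (hsum s).tsum_le_tsum
    (fun n => by gcongr; exact hhm _ hst) (hsum t)
  have hφlt {s t} (hst : s < t) (hgst : g s ≠ g t) : φ s < φ t := by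
    obtain ⟨n, hn⟩ := hlt hst hgst
    exact Summable.tsum_lt_tsum (i := n) (fun n => by gcongr; exact hhm _ hst.le)
      (by gcongr) (hsum s) (hsum t)
  have hφ {s t} : φ s = φ t ↔ g s = g t := by
    wlog hst : s < t generalizing s t
    · rcases (not_lt.1 hst).eq_or_lt with rfl | hlt'
      · simp
      · rw [eq_comm, this hlt', eq_comm]
    refine ⟨fun heq => ?_, fun heq => ?_⟩
    · by_contra hcon
      exact (hφlt hst hcon).ne heq
    · simp only [φ, hconst hst heq]
  have hφ1 : 0 < φ 1 := hφ0 ▸ hφlt zero_lt_one hne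
  let ψ : C(unitInterval, unitInterval) :=
    ⟨fun t => ⟨φ t / φ 1, div_nonneg (hφ0 ▸ hφm unitInterval.nonneg') hφ1.le,
      (div_le_one hφ1).2 (hφm unitInterval.le_one')⟩,
      Continuous.subtype_mk (hφc.div_const _) _⟩
  have hψ {s t} : ψ s = ψ t ↔ g s = g t := by
    rw [← hφ, Subtype.ext_iff]
    exact div_left_inj' hφ1.ne'
  have hψ0 : ψ 0 = 0 := Subtype.ext (by change φ 0 / φ 1 = 0; rw [hφ0, zero_div])
  have hψ1 : ψ 1 = 1 := Subtype.ext (div_self hφ1.ne')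
  have hsurj : Function.Surjective ψ := by
    intro y
    have := intermediate_value_univ 0 1 ψ.continuous
    rw [hψ0, hψ1] at this
    exact this ⟨unitInterval.nonneg', unitInterval.le_one'⟩
  have hq : Topology.IsQuotientMap ψ := .of_surjective_continuous hsurj ψ.continuous
  have hfac : Function.FactorsThrough g ψ := fun s t hst => hψ.1 hst
  have hlift (t) : hq.lift g hfac (ψ t) = g t :=
    DFunLike.congr_fun (Topology.IsQuotientMap.lift_comp hq g hfac) t
  refine ⟨hq.lift g hfac, fun a b hab => ?_, ?_, ?_, ?_⟩
  · obtain ⟨s, rfl⟩ := hsurj a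
    obtain ⟨t, rfl⟩ := hsurj b
    rw [hlift, hlift] at hab
    exact hψ.2 hab
  · rw [← hlift 0, hψ0]
  · rw [← hlift 1, hψ1]
  · rintro _ ⟨a, rfl⟩
    obtain ⟨s, rfl⟩ := hsurj a
    exact ⟨s, (hlift s).symm⟩

/-- `A` is a closed subset of `[0, 1]` containing the endpoints such that `γ` takes the same value
at both ends of each gap of `A`. -/
structure IsShortcutSet {X : Type*} (γ : ℝ → X) (A : Set ℝ) : Prop where
  isClosed : IsClosed A
  subset_Icc : A ⊆ Set.Icc 0 1
  zero_mem : 0 ∈ A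
  one_mem : 1 ∈ A
  gap : ∀ a ∈ A, ∀ b ∈ A, a < b → (∀ u ∈ A, u ∉ Set.Ioo a b) → γ a = γ b

theorem exists_minimal_isShortcutSet {X : Type*} [TopologicalSpace X] [T2Space X] {γ : ℝ → X}
    (hγ : Continuous γ) : ∃ A, Minimal (IsShortcutSet γ) A := by
  have hI : IsShortcutSet γ (Set.Icc 0 1) := by
    refine ⟨isClosed_Icc, subset_rfl, by simp, by simp, fun a ha b hb hab h => ?_⟩
    obtain ⟨u, hu⟩ := exists_between hab
    exact (h u ⟨ha.1.trans hu.1.le, hu.2.le.trans hb.2⟩ hu).elim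
  refine (zorn_superset_nonempty {A | IsShortcutSet γ A} (fun c hc hchain hne => ?_) _ hI).imp
    fun A hA => hA.2
  refine ⟨⋂₀ c, ⟨isClosed_sInter fun A hA => (hc hA).isClosed, ?_,
    fun A hA => (hc hA).zero_mem, fun A hA => (hc hA).one_mem, ?_⟩,
    fun A hA => Set.sInter_subset_of_mem hA⟩
  · obtain ⟨A, hA⟩ := hne
    exact (Set.sInter_subset_of_mem hA).trans (hc hA).subset_Icc
  intro a ha b hb hab hgap
  by_contra hcon
  obtain ⟨η, hη, hηab, hsep⟩ : ∃ η > 0, a + η < b - η ∧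
      ∀ a' ∈ Set.Icc a (a + η), ∀ b' ∈ Set.Icc (b - η) b, γ a' ≠ γ b' := by
    have hW : IsOpen {x : ℝ × ℝ | γ x.1 ≠ γ x.2} :=
      isOpen_ne_fun (hγ.comp continuous_fst) (hγ.comp continuous_snd)
    obtain ⟨r, hr, h⟩ := Metric.isOpen_iff.1 hW (a, b) hcon
    refine ⟨min (r / 2) ((b - a) / 3), lt_min (half_pos hr) (by linarith), ?_,
      fun a' ha' b' hb' => h (show (a', b') ∈ _ from ?_)⟩
    · linarith [min_le_right (r / 2) ((b - a) / 3)]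
    · rw [Metric.mem_ball, Prod.dist_eq, max_lt_iff, Real.dist_eq, Real.dist_eq, abs_lt, abs_lt]
      have := min_le_left (r / 2) ((b - a) / 3)
      obtain ⟨h1, h2⟩ := ha'
      obtain ⟨h3, h4⟩ := hb'
      dsimp only
      refine ⟨⟨?_, ?_⟩, ?_, ?_⟩ <;> linarith
  obtain ⟨A, hA, hAK⟩ : ∃ A ∈ c, ∀ u ∈ A, u ∉ Set.Icc (a + η) (b - η) := by
    by_contra! hall
    have : (⋂₀ ((fun A => A ∩ Set.Icc (a + η) (b - η)) '' c)).Nonempty := by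
      have : Nonempty ((fun A => A ∩ Set.Icc (a + η) (b - η)) '' c) := (hne.image _).to_subtype
      refine IsCompact.nonempty_sInter_of_directed_nonempty_isCompact_isClosed ?_ ?_ ?_ ?_
      · rintro _ ⟨A, hA, rfl⟩ _ ⟨B, hB, rfl⟩
        rcases hchain.total hA hB with h | h
        · exact ⟨_, ⟨A, hA, rfl⟩, subset_rfl, Set.inter_subset_inter_left _ h⟩
        · exact ⟨_, ⟨B, hB, rfl⟩, Set.inter_subset_inter_left _ h, subset_rfl⟩
      · rintro _ ⟨A, hA, rfl⟩
        obtain ⟨u, hu, hu'⟩ := hall A hA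
        exact ⟨u, hu, hu'⟩
      · rintro _ ⟨A, hA, rfl⟩
        exact isCompact_Icc.inter_left (hc hA).isClosed
      · rintro _ ⟨A, hA, rfl⟩
        exact (hc hA).isClosed.inter isClosed_Icc
    obtain ⟨u, hu⟩ := this
    have hu' (A) (hA : A ∈ c) : u ∈ A ∩ Set.Icc (a + η) (b - η) := hu _ ⟨A, hA, rfl⟩
    obtain ⟨A, hA⟩ := hne
    have h1 := (hu' A hA).2
    exact hgap u (fun B hB => (hu' B hB).1) ⟨by linarith [h1.1], by linarith [h1.2]⟩
  obtain ⟨⟨haA, ha'⟩, ha_max⟩ :=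
    (isCompact_Icc.inter_left (hc hA).isClosed).isGreatest_sSup
      (s := A ∩ Set.Icc a (a + η)) ⟨a, ha A hA, le_rfl, by linarith⟩
  obtain ⟨⟨hbA, hb'⟩, hb_min⟩ :=
    (isCompact_Icc.inter_left (hc hA).isClosed).isLeast_sInf
      (s := A ∩ Set.Icc (b - η) b) ⟨b, hb A hA, by linarith, le_rfl⟩
  refine hsep _ ha' _ hb' ((hc hA).gap _ haA _ hbA (by linarith [ha'.2, hb'.1])
    fun u hu hu' => ?_)
  rcases le_or_gt u (a + η) with h1 | h1
  · exact hu'.1.not_ge (ha_max ⟨hu, ha'.1.trans hu'.1.le, h1⟩)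
  rcases le_or_gt (b - η) u with h2 | h2
  · exact hu'.2.not_ge (hb_min ⟨hu, h2, hu'.2.le.trans hb'.2⟩)
  exact hAK u hu ⟨h1.le, h2.le⟩

theorem IsShortcutSet.notMem_Ioo_of_minimal {X : Type*} {γ : ℝ → X} {A : Set ℝ}
    (hA : Minimal (IsShortcutSet γ) A) {a b : ℝ} (ha : a ∈ A) (hb : b ∈ A) (hγ : γ a = γ b)
    {u : ℝ} (hu : u ∈ A) : u ∉ Set.Ioo a b := by
  have hcut : IsShortcutSet γ (A \ Set.Ioo a b) := by
    refine ⟨hA.prop.isClosed.sdiff isOpen_Ioo, Set.sdiff_subset.trans hA.prop.subset_Icc,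
      ⟨hA.prop.zero_mem, fun h => h.1.not_ge (hA.prop.subset_Icc ha).1⟩,
      ⟨hA.prop.one_mem, fun h => h.2.not_ge (hA.prop.subset_Icc hb).2⟩, ?_⟩
    rintro p ⟨hp, hp'⟩ q ⟨hq, hq'⟩ hpq hgap
    by_cases hv : ∃ v ∈ A, v ∈ Set.Ioo p q
    · obtain ⟨v, hv, hv'⟩ := hv
      have hvab : v ∈ Set.Ioo a b := by
        by_contra hcon
        exact hgap v ⟨hv, hcon⟩ hv'
      have h1 := hgap a ⟨ha, fun h => h.1.false⟩
      have h2 := hgap b ⟨hb, fun h => h.2.false⟩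
      simp only [Set.mem_Ioo, not_and, not_lt] at *
      have hpa : p = a := le_antisymm
        (not_lt.1 fun h => by linarith [hp' h, hv'.1, hvab.2])
        (not_lt.1 fun h => by linarith [h1 h, hv'.2, hvab.1])
      have hqb : q = b := le_antisymm
        (not_lt.1 fun h => by linarith [h2 (by linarith)])
        (not_lt.1 fun h => by linarith [hq' (by linarith)])
      rw [hpa, hqb, hγ]
    · exact hA.prop.gap p hp q hq hpq fun v hv' hvpq => hv ⟨v, hv', hvpq⟩
  exact (hA.le_of_le hcut Set.sdiff_subset hu).2

/-- A curve can be replaced by one with the same endpoints, contained in it, whose fibres are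
intervals. -/
theorem exists_monotone_curve {X : Type*} [MetricSpace X] {γ : ℝ → X} (hγ : Continuous γ) :
    ∃ g : C(unitInterval, X), g 0 = γ 0 ∧ g 1 = γ 1 ∧ Set.range g ⊆ γ '' Set.Icc 0 1 ∧
      ∀ s t, s < t → g s = g t → ∀ u ∈ Set.Icc s t, g u = g s := by
  obtain ⟨A, hA⟩ := exists_minimal_isShortcutSet hγ
  let L (t : ℝ) : ℝ := sSup (A ∩ Set.Icc 0 t)
  let R (t : ℝ) : ℝ := sInf (A ∩ Set.Icc t 1)
  have hL {t : ℝ} (ht : 0 ≤ t) : IsGreatest (A ∩ Set.Icc 0 t) (L t) :=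
    (isCompact_Icc.inter_left hA.prop.isClosed).isGreatest_sSup
      ⟨0, hA.prop.zero_mem, le_rfl, ht⟩
  have hR {t : ℝ} (ht : t ≤ 1) : IsLeast (A ∩ Set.Icc t 1) (R t) :=
    (isCompact_Icc.inter_left hA.prop.isClosed).isLeast_sInf
      ⟨1, hA.prop.one_mem, ht, le_rfl⟩
  have hLA {t : ℝ} (ht : 0 ≤ t) : L t ∈ A := (hL ht).1.1
  have hLmono {s t : ℝ} (hs : 0 ≤ s) (hst : s ≤ t) : L s ≤ L t :=
    (hL (hs.trans hst)).2 ⟨hLA hs, (hL hs).1.2.1, (hL hs).1.2.2.trans hst⟩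
  have hLfix {t : ℝ} (ht : t ∈ A) : L t = t :=
    have ht0 := (hA.prop.subset_Icc ht).1
    le_antisymm (hL ht0).1.2.2 ((hL ht0).2 ⟨ht, ht0, le_rfl⟩)
  have hLR {t : ℝ} (ht0 : 0 ≤ t) (ht1 : t ≤ 1) : γ (L t) = γ (R t) := by
    rcases ((hL ht0).1.2.2.trans (hR ht1).1.2.1).eq_or_lt with h | h
    · rw [h]
    · refine hA.prop.gap _ (hLA ht0) _ (hR ht1).1.1 h fun u hu hu' => ?_
      have hu01 := hA.prop.subset_Icc hu
      rcases le_total u t with h' | h'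
      · exact hu'.1.not_ge ((hL ht0).2 ⟨hu, hu01.1, h'⟩)
      · exact hu'.2.not_ge ((hR ht1).2 ⟨hu, h', hu01.2⟩)
  have hcont : Continuous fun t : unitInterval => γ (L t) := by
    refine Metric.continuous_iff'.2 fun t₀ ε hε => ?_
    obtain ⟨δ, hδ, h⟩ := Metric.uniformContinuousOn_iff.1
      (isCompact_Icc.uniformContinuousOn_of_continuous (hγ.continuousOn (s := Set.Icc 0 1))) ε hε
    have key (s t : unitInterval) (hst : s ≤ t) (hd : dist s t < δ) :
        dist (γ (L s)) (γ (L t)) < ε := by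
      have hst' : (s : ℝ) ≤ t := hst
      by_cases hAst : ∃ u ∈ A, u ∈ Set.Icc (s : ℝ) t
      · obtain ⟨u, hu, hsu, hut⟩ := hAst
        have h1 := (hR s.2.2).1.2
        have h2 := (hR s.2.2).2 ⟨hu, hsu, (hA.prop.subset_Icc hu).2⟩
        have h3 := (hL t.2.1).1.2
        have h4 := (hL t.2.1).2 ⟨hu, (hA.prop.subset_Icc hu).1, hut⟩
        rw [hLR s.2.1 s.2.2]
        refine h _ ⟨s.2.1.trans h1.1, h1.2⟩ _ ⟨h3.1, h3.2.trans t.2.2⟩ ?_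
        rw [Subtype.dist_eq, Real.dist_eq, abs_lt] at hd
        rw [Real.dist_eq, abs_lt]
        constructor <;> linarith [h1.1, h3.2, hd.1, hd.2]
      · have : L s = L t := by
          refine le_antisymm (hLmono s.2.1 hst') ((hL s.2.1).2 ⟨hLA t.2.1, (hL t.2.1).1.2.1, ?_⟩)
          by_contra! hcon
          exact hAst ⟨L t, hLA t.2.1, hcon.le, (hL t.2.1).1.2.2⟩
        rwa [this, dist_self]
    filter_upwards [Metric.ball_mem_nhds t₀ hδ] with t ht
    rcases le_total t t₀ with hle | hle
    · exact key t t₀ hle ht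
    · rw [dist_comm]
      exact key t₀ t hle (by rwa [dist_comm])
  refine ⟨⟨_, hcont⟩, ?_, ?_, ?_, fun s t hst heq u hu => ?_⟩
  · simp [hLfix hA.prop.zero_mem]
  · simp [hLfix hA.prop.one_mem]
  · rintro _ ⟨t, rfl⟩
    exact ⟨L t, hA.prop.subset_Icc (hLA t.2.1), rfl⟩
  · change γ (L s) = γ (L t) at heq
    change γ (L u) = γ (L s)
    have h := IsShortcutSet.notMem_Ioo_of_minimal hA (hLA s.2.1) (hLA t.2.1) heq (hLA u.2.1)
    rcases (hLmono s.2.1 hu.1).eq_or_lt with h1 | h1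
    · rw [h1]
    rcases (hLmono u.2.1 hu.2).eq_or_lt with h2 | h2
    · rw [h2, heq]
    exact (h ⟨h1, h2⟩).elim

theorem JoinedIn.exists_isArc_subset {X : Type*} [MetricSpace X] {U : Set X} {x y : X}
    (h : JoinedIn U x y) : ∃ A ⊆ U, IsArc A x y := by
  by_cases hxy : x = y
  · exact ⟨{x}, Set.singleton_subset_iff.2 h.mem.1, Or.inl ⟨hxy, rfl⟩⟩
  obtain ⟨γ, hγ⟩ := h
  obtain ⟨g, hg0, hg1, hgγ, hg⟩ := exists_monotone_curve γ.continuous_extend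
  rw [γ.extend_zero] at hg0
  rw [γ.extend_one] at hg1
  obtain ⟨f, hf, hf0, hf1, hfg⟩ := exists_injective_reparam g (by rwa [hg0, hg1]) hg
  refine ⟨Set.range f, ?_, Or.inr ⟨hxy, fun t => f (Set.projIcc 0 1 zero_le_one t),
    (f.continuous.comp continuous_projIcc).continuousOn, fun s hs t ht hst => ?_, ?_, ?_, ?_⟩⟩
  · refine (hfg.trans hgγ).trans ?_
    rintro _ ⟨t, ht, rfl⟩
    rw [γ.extend_apply ht]
    exact hγ _
  · have := hf hst
    rwa [Set.projIcc_of_mem _ hs, Set.projIcc_of_mem _ ht, Subtype.mk.injEq] at this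
  · simpa [hg0] using hf0
  · simpa [hg1] using hf1
  · ext p
    constructor
    · rintro ⟨t, rfl⟩
      exact ⟨t, t.2, by simp⟩
    · rintro ⟨t, -, rfl⟩
      exact ⟨_, rfl⟩

theorem isArc_treeArc {T : Type*} [MetricSpace T] (hT : IsMetricTree T) (x y : T) :
    IsArc (treeArc hT x y) x y :=
  (hT.arcUnique x y).choose_spec.1

theorem IsArc.eq_treeArc {T : Type*} [MetricSpace T] (hT : IsMetricTree T) {x y : T} {A : Set T}
    (hA : IsArc A x y) : A = treeArc hT x y :=
  (hT.arcUnique x y).choose_spec.2 A hA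

/-- An interior point of the arc `[x, y]` of a metric tree separates `x` from `y`. -/
theorem IsMetricTree.notMem_connectedComponentIn_of_mem_treeArc {T : Type*} [MetricSpace T]
    (hT : IsMetricTree T) {x y c : T} (hc : c ∈ treeArc hT x y) (hx : c ≠ x) :
    y ∉ connectedComponentIn (Set.univ \ {c}) x := by
  intro hy
  have := hT.compact
  have := hT.locConn
  have := LocallyPathConnectedSpace.of_compact_locallyConnected T
  have hopen : IsOpen (connectedComponentIn (Set.univ \ {c}) x) :=
    (isOpen_univ.sdiff isClosed_singleton).connectedComponentIn
  have hxm : x ∈ Set.univ \ {c} := ⟨trivial, hx.symm⟩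
  obtain ⟨A, hAU, hA⟩ := ((hopen.isConnected_iff_isPathConnected.1
    (isConnected_connectedComponentIn_iff.2 hxm)).joinedIn x (mem_connectedComponentIn hxm)
      y hy).exists_isArc_subset
  rw [hA.eq_treeArc hT] at hAU
  exact (connectedComponentIn_subset _ _ (hAU hc)).2 rfl

section Branches

variable {X : Type*} [MetricSpace X] [LocallyConnectedSpace X]

theorem closure_connectedComponentIn_ne {c x y : X} (hx : x ≠ c)
    (hxy : y ∉ connectedComponentIn (Set.univ \ {c}) x) :
    closure (connectedComponentIn (Set.univ \ {c}) x) ≠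
      closure (connectedComponentIn (Set.univ \ {c}) y) := by
  intro heq
  have hopen : IsOpen (connectedComponentIn (Set.univ \ {c}) x) :=
    (isOpen_univ.sdiff isClosed_singleton).connectedComponentIn
  have hxm : x ∈ connectedComponentIn (Set.univ \ {c}) x :=
    mem_connectedComponentIn ⟨trivial, hx⟩
  obtain ⟨u, hux, huy⟩ := mem_closure_iff.1 (heq ▸ subset_closure hxm :
    x ∈ closure (connectedComponentIn (Set.univ \ {c}) y)) _ hopen hxm
  have h := (connectedComponentIn_eq hux).trans (connectedComponentIn_eq huy).symm
  refine hxy (h ▸ mem_connectedComponentIn (connectedComponentIn_nonempty_iff.1 ⟨u, huy⟩))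

/-- A branch of `x` whose underlying component misses `c` lies in the component of `x` in the
complement of `c`. -/
theorem closure_connectedComponentIn_subset [PreconnectedSpace X] {c x q : X} (hx : x ≠ c)
    (hq : q ≠ x) (hcq : c ∉ connectedComponentIn (Set.univ \ {x}) q) :
    closure (connectedComponentIn (Set.univ \ {x}) q) ⊆
      connectedComponentIn (Set.univ \ {c}) x := by
  set V := connectedComponentIn (Set.univ \ {x}) q with hV
  have hopen {p r : X} : IsOpen (connectedComponentIn (Set.univ \ {p}) r) :=
    (isOpen_univ.sdiff isClosed_singleton).connectedComponentIn
  have hqV : q ∈ V := mem_connectedComponentIn ⟨trivial, hq⟩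
  have hclV : closure V ⊆ insert x V := by
    intro p hp
    by_contra hcon
    rw [Set.mem_insert_iff, not_or] at hcon
    obtain ⟨u, hup, huV⟩ := mem_closure_iff.1 hp _ hopen
      (mem_connectedComponentIn (F := Set.univ \ {x}) ⟨trivial, hcon.1⟩)
    refine hcon.2 ?_
    rw [hV, connectedComponentIn_eq huV, ← connectedComponentIn_eq hup]
    exact mem_connectedComponentIn ⟨trivial, hcon.1⟩
  have hxV : x ∈ closure V := by
    by_contra hcon
    have hclosed : IsClosed V := by
      refine closure_subset_iff_isClosed.1 fun p hp => ?_
      rcases hclV hp with rfl | h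
      exacts [(hcon hp).elim, h]
    have huniv : V = Set.univ := IsClopen.eq_univ ⟨hclosed, hopen⟩ ⟨q, hqV⟩
    exact hcon (subset_closure (huniv ▸ trivial))
  refine isPreconnected_connectedComponentIn.closure.subset_connectedComponentIn hxV
    fun p hp => ⟨trivial, ?_⟩
  rintro rfl
  rcases hclV hp with h | h
  exacts [hx h.symm, hcq h]

theorem treeHeight_le_diam [CompactSpace X] [PreconnectedSpace X] {c x : X} (hx : x ≠ c) :
    treeHeight x ≤ Metric.diam (closure (connectedComponentIn (Set.univ \ {c}) x)) := by
  refine Real.sSup_le ?_ Metric.diam_nonneg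
  rintro _ ⟨_, _, _, ⟨q₁, hq₁, rfl⟩, ⟨q₂, hq₂, rfl⟩, -, hne, -, -, rfl⟩
  have key {q : X} (hq : q ∈ Set.univ \ {x})
      (hcq : c ∉ connectedComponentIn (Set.univ \ {x}) q) :
      Metric.diam (closure (connectedComponentIn (Set.univ \ {x}) q)) ≤
        Metric.diam (closure (connectedComponentIn (Set.univ \ {c}) x)) :=
    Metric.diam_mono ((closure_connectedComponentIn_subset hx hq.2 hcq).trans subset_closure)
      isClosed_closure.isCompact.isBounded
  by_cases h₁ : c ∈ connectedComponentIn (Set.univ \ {x}) q₁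
  · refine (min_le_right _ _).trans ((min_le_left _ _).trans (key hq₂ fun h₂ => hne ?_))
    rw [connectedComponentIn_eq h₁, connectedComponentIn_eq h₂]
  · exact (min_le_left _ _).trans (key hq₁ h₁)

end Branches

theorem stmt11 {T : Type*} [MetricSpace T] (hT : IsMetricTree T) (x y z c : T)
    (hx : IsBranchPoint x) (hy : IsBranchPoint y) (hz : IsBranchPoint z)
    (hc : treeArc hT x y ∩ treeArc hT y z ∩ treeArc hT z x = {c}) :
    IsBranchPoint c ∧
      min (treeHeight x) (min (treeHeight y) (treeHeight z)) ≤ treeHeight c := by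
  obtain ⟨⟨hxy, hyz⟩, hzx⟩ : c ∈ treeArc hT x y ∩ treeArc hT y z ∩ treeArc hT z x := by
    rw [hc, Set.mem_singleton_iff]
  by_cases hcx : c = x
  · subst hcx
    exact ⟨hx, min_le_left _ _⟩
  by_cases hcy : c = y
  · subst hcy
    exact ⟨hy, (min_le_right _ _).trans (min_le_left _ _)⟩
  by_cases hcz : c = z
  · subst hcz
    exact ⟨hz, (min_le_right _ _).trans (min_le_right _ _)⟩
  have := hT.compact
  have := hT.conn
  have := hT.locConn
  let B (p : T) : Set T := closure (connectedComponentIn (Set.univ \ {c}) p)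
  have hB {p : T} (hp : c ≠ p) : IsBranchIn Set.univ c (B p) := ⟨p, ⟨trivial, hp.symm⟩, rfl⟩
  have hne {p q : T} (hp : c ≠ p) (hpq : c ∈ treeArc hT p q) : B p ≠ B q :=
    closure_connectedComponentIn_ne hp.symm
      (hT.notMem_connectedComponentIn_of_mem_treeArc hpq hp)
  have h₁₂ := hne hcx hxy
  have h₁₃ := (hne hcz hzx).symm
  have h₂₃ := hne hcy hyz
  refine ⟨⟨B x, B y, B z, hB hcx, hB hcy, hB hcz, h₁₂, h₁₃, h₂₃⟩, ?_⟩
  have hbdd : BddAbove {r : ℝ | ∃ B₁ B₂ B₃ : Set T, IsBranchIn Set.univ c B₁ ∧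
      IsBranchIn Set.univ c B₂ ∧ IsBranchIn Set.univ c B₃ ∧ B₁ ≠ B₂ ∧ B₁ ≠ B₃ ∧ B₂ ≠ B₃ ∧
      r = min (Metric.diam B₁) (min (Metric.diam B₂) (Metric.diam B₃))} := by
    refine ⟨Metric.diam (Set.univ : Set T), ?_⟩
    rintro _ ⟨B₁, _, _, -, -, -, -, -, -, rfl⟩
    exact (min_le_left _ _).trans
      (Metric.diam_mono (Set.subset_univ _) isCompact_univ.isBounded)
  refine le_trans ?_
    (le_csSup hbdd ⟨B x, B y, B z, hB hcx, hB hcy, hB hcz, h₁₂, h₁₃, h₂₃, rfl⟩)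
  exact min_le_min (treeHeight_le_diam (Ne.symm hcx))
    (min_le_min (treeHeight_le_diam (Ne.symm hcy)) (treeHeight_le_diam (Ne.symm hcz)))
end

section
/- The continuum self-similar tree T (attractor of g₁(z)=z/2−1/2, g₂(z)=z̄/2+1/2, g₃(z)=iz̄/2+i/2 in ℂ) is uniformly branching: there is a constant C ≥ 1 such that (a) |p−q| ≥ (1/C)·min{H_T(p), H_T(q)} for all distinct branch points p,q of T, and (b) for all distinct x,y ∈ T there is a branch point p ∈ [x,y] with H_T(p) ≥ (1/C)·|x−y|. -/
open Complex

/-- The three similarities generating the continuum self-similar tree: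
`g₁(z) = z/2 - 1/2`, `g₂(z) = z̄/2 + 1/2`, `g₃(z) = i·z̄/2 + i/2`. -/
noncomputable def csstMap : Fin 3 → ℂ → ℂ :=
  ![fun z => z / 2 - 1 / 2,
    fun z => (starRingEnd ℂ) z / 2 + 1 / 2,
    fun z => Complex.I * (starRingEnd ℂ) z / 2 + Complex.I / 2]

/-- `g_w = g_{w₁} ∘ ⋯ ∘ g_{wₙ}` for a finite word `w` over the alphabet `{1,2,3}`. -/
noncomputable def csstWord : List (Fin 3) → ℂ → ℂ
  | [] => id
  | i :: w => csstMap i ∘ csstWord w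

/-- `T` is the continuum self-similar tree: the (unique) nonempty compact
attractor of the iterated function system `{g₁, g₂, g₃}`. -/
def IsCSST (T : Set ℂ) : Prop :=
  T.Nonempty ∧ IsCompact T ∧
    T = csstMap 0 '' T ∪ csstMap 1 '' T ∪ csstMap 2 '' T

namespace CSST

@[simp] lemma map_zero_re (z : ℂ) : (csstMap 0 z).re = z.re / 2 - 1 / 2 := by
  simp [csstMap]

@[simp] lemma map_zero_im (z : ℂ) : (csstMap 0 z).im = z.im / 2 := by
  simp [csstMap]

@[simp] lemma map_one_re (z : ℂ) : (csstMap 1 z).re = z.re / 2 + 1 / 2 := by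
  simp [csstMap]

@[simp] lemma map_one_im (z : ℂ) : (csstMap 1 z).im = -z.im / 2 := by
  simp [csstMap]

@[simp] lemma map_two_re (z : ℂ) : (csstMap 2 z).re = z.im / 2 := by
  simp [csstMap]

@[simp] lemma map_two_im (z : ℂ) : (csstMap 2 z).im = z.re / 2 + 1 / 2 := by
  simp [csstMap]

lemma dist_map (i : Fin 3) (a b : ℂ) : dist (csstMap i a) (csstMap i b) = dist a b / 2 := by
  have h : ∀ x y : ℝ, √((x / 2) ^ 2 + (y / 2) ^ 2) = √(x ^ 2 + y ^ 2) / 2 := by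
    intro x y
    rw [show (x / 2) ^ 2 + (y / 2) ^ 2 = (x ^ 2 + y ^ 2) / 2 ^ 2 by ring,
      Real.sqrt_div (by positivity), Real.sqrt_sq (by norm_num)]
  rw [Complex.dist_eq_re_im, Complex.dist_eq_re_im, ← h]
  fin_cases i <;> simp <;> ring_nf

lemma continuous_map (i : Fin 3) : Continuous (csstMap i) :=
  (LipschitzWith.of_dist_le_mul (K := 1) fun a b => by
    rw [dist_map, NNReal.coe_one]; linarith [dist_nonneg (x := a) (y := b)]).continuous

lemma map_injective (i : Fin 3) : Function.Injective (csstMap i) := by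
  intro a b h
  have := dist_map i a b
  rw [h, dist_self] at this
  exact dist_le_zero.1 (by linarith)

lemma dist_word (w : List (Fin 3)) (a b : ℂ) :
    dist (csstWord w a) (csstWord w b) = dist a b * (1 / 2) ^ w.length := by
  induction w with
  | nil => simp [csstWord]
  | cons i w ih =>
    simp only [csstWord, Function.comp, dist_map, ih, List.length_cons, pow_succ]
    ring

lemma word_injective (w : List (Fin 3)) : Function.Injective (csstWord w) := by
  intro a b h
  have := dist_word w a b
  rw [h, dist_self] at this
  have h2 : (0 : ℝ) < (1 / 2) ^ w.length := by positivity
  exact dist_le_zero.1 (by nlinarith [dist_nonneg (x := a) (y := b)])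

lemma continuous_word (w : List (Fin 3)) : Continuous (csstWord w) := by
  induction w with
  | nil => exact continuous_id
  | cons i w ih => exact (continuous_map i).comp ih

/-- The preimage of the central point `0` under each generator. -/
noncomputable def root : Fin 3 → ℂ := ![1, -1, -1]

lemma map_root (i : Fin 3) : csstMap i (root i) = 0 := by
  fin_cases i <;> apply Complex.ext <;> simp [root] <;> norm_num

lemma root_eq (i : Fin 3) : root i = 1 ∨ root i = -1 := by
  fin_cases i <;> simp [root]

/-- A bounded set covered by its images lies in every nonempty closed forward invariant set. -/
lemma subset_of_invariant {S K : Set ℂ} (hS : Bornology.IsBounded S) (hK : IsClosed K)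
    (hne : K.Nonempty) (hSs : ∀ x ∈ S, ∃ i, ∃ y ∈ S, csstMap i y = x)
    (hKs : ∀ i, ∀ y ∈ K, csstMap i y ∈ K) : S ⊆ K := by
  obtain ⟨k, hk⟩ := hne
  obtain ⟨M, hM⟩ := hS.subset_closedBall k
  have key : ∀ n : ℕ, ∀ x ∈ S, ∃ y ∈ K, dist x y ≤ M * (1 / 2) ^ n := by
    intro n
    induction n with
    | zero => intro x hx; exact ⟨k, hk, by simpa using hM hx⟩
    | succ n ih =>
      intro x hx
      obtain ⟨i, y, hy, rfl⟩ := hSs x hx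
      obtain ⟨z, hz, hd⟩ := ih y hy
      refine ⟨_, hKs i z hz, ?_⟩
      rw [dist_map, pow_succ]; linarith
  intro x hx
  rw [← hK.closure_eq, Metric.mem_closure_iff]
  intro ε hε
  have ht : Filter.Tendsto (fun n : ℕ => M * (1 / 2 : ℝ) ^ n) Filter.atTop (nhds (M * 0)) :=
    (tendsto_pow_atTop_nhds_zero_of_lt_one (by norm_num) (by norm_num)).const_mul M
  rw [mul_zero] at ht
  obtain ⟨n, hn⟩ := (ht.eventually (gt_mem_nhds hε)).exists
  obtain ⟨y, hy, hd⟩ := key n x hx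
  exact ⟨y, hy, hd.trans_lt hn⟩

/-- The closed quadrilateral with vertices `-1`, `i`, `1` and `(1 - i) / 2`. -/
def hull : Set ℂ :=
  {z | z.im ≤ z.re + 1 ∧ z.im ≤ 1 - z.re ∧ -(z.re + 1) ≤ 3 * z.im ∧ z.re - 1 ≤ z.im}

lemma isClosed_hull : IsClosed hull := by
  have hr := Complex.continuous_re
  have hi := Complex.continuous_im
  exact (isClosed_le hi (hr.add continuous_const)).inter
    ((isClosed_le hi (continuous_const.sub hr)).inter
      ((isClosed_le (hr.add continuous_const).neg (continuous_const.mul hi)).inter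
        (isClosed_le (hr.sub continuous_const) hi)))

lemma map_mem_hull (i : Fin 3) (z : ℂ) (hz : z ∈ hull) : csstMap i z ∈ hull := by
  obtain ⟨h1, h2, h3, h4⟩ := hz
  fin_cases i <;> refine ⟨?_, ?_, ?_, ?_⟩ <;> simp <;> linarith

lemma norm_le_two_of_mem_hull {z : ℂ} (hz : z ∈ hull) : ‖z‖ ≤ 2 := by
  obtain ⟨h1, h2, h3, h4⟩ := hz
  refine (Complex.norm_le_abs_re_add_abs_im z).trans ?_
  have := abs_le.2 ⟨(by linarith : -1 ≤ z.re), (by linarith : z.re ≤ 1)⟩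
  have := abs_le.2 ⟨(by linarith : -1 ≤ z.im), (by linarith : z.im ≤ 1)⟩
  linarith

/-- Distinct first-level pieces meet at a definite angle at `0`. -/
lemma norm_le_of_mem_hull {i j : Fin 3} (hij : i ≠ j) {a b : ℂ} (ha : a ∈ hull)
    (hb : b ∈ hull) : ‖csstMap i a‖ ≤ 8 * dist (csstMap i a) (csstMap j b) := by
  obtain ⟨a1, a2, a3, a4⟩ := ha
  obtain ⟨b1, b2, b3, b4⟩ := hb
  have hx := Complex.abs_re_le_norm (csstMap i a - csstMap j b)
  have hy := Complex.abs_im_le_norm (csstMap i a - csstMap j b)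
  rw [← dist_eq_norm] at hx hy
  set d := dist (csstMap i a) (csstMap j b)
  rw [abs_le] at hx hy
  obtain ⟨x1, x2⟩ := hx
  obtain ⟨y1, y2⟩ := hy
  rw [Complex.sub_re] at x1 x2
  rw [Complex.sub_im] at y1 y2
  suffices h : |(csstMap i a).re| ≤ 4 * d ∧ |(csstMap i a).im| ≤ 4 * d by
    refine (Complex.norm_le_abs_re_add_abs_im _).trans ?_
    linarith [h.1, h.2]
  clear_value d
  rw [abs_le, abs_le]
  fin_cases i <;> fin_cases j <;> simp at hij x1 x2 y1 y2 ⊢ <;>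
    refine ⟨⟨?_, ?_⟩, ?_, ?_⟩ <;> linarith

/-- The pieces not containing `1` or `-1` stay away from it. -/
lemma map_eq_or_half_le (i : Fin 3) {e : ℂ} (he : e = 1 ∨ e = -1) :
    csstMap i e = e ∨ ∀ z ∈ hull, 1 / 2 ≤ dist (csstMap i z) e := by
  have key : ∀ z : ℂ, 1 / 2 ≤ |z.re - e.re| → 1 / 2 ≤ dist z e := by
    intro z h
    have := Complex.abs_re_le_norm (z - e)
    rw [← dist_eq_norm, Complex.sub_re] at this
    linarith
  rcases he with rfl | rfl <;> fin_cases i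
  · right; rintro z ⟨h1, h2, h3, h4⟩
    apply key; rw [le_abs]; right; simp; linarith
  · left; apply Complex.ext <;> simp; norm_num
  · right; rintro z ⟨h1, h2, h3, h4⟩
    apply key; rw [le_abs]; right; simp; linarith
  · left; apply Complex.ext <;> simp; norm_num
  · right; rintro z ⟨h1, h2, h3, h4⟩
    apply key; rw [le_abs]; left; simp; linarith
  · right; rintro z ⟨h1, h2, h3, h4⟩
    apply key; rw [le_abs]; left; simp; linarith

lemma one_mem_hull : (1 : ℂ) ∈ hull := by
  refine ⟨?_, ?_, ?_, ?_⟩ <;> norm_num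

lemma neg_one_mem_hull : (-1 : ℂ) ∈ hull := by
  refine ⟨?_, ?_, ?_, ?_⟩ <;> norm_num

lemma zero_mem_hull : (0 : ℂ) ∈ hull := by
  refine ⟨?_, ?_, ?_, ?_⟩ <;> norm_num

lemma word_mem_hull (w : List (Fin 3)) {z : ℂ} (hz : z ∈ hull) : csstWord w z ∈ hull := by
  induction w with
  | nil => exact hz
  | cons i w ih => exact map_mem_hull i _ ih

/-- The images of `±1` under words of length `n`. -/
def IsCorner : ℕ → ℂ → Prop
  | 0, z => z = 1 ∨ z = -1
  | n + 1, z => ∃ i y, IsCorner n y ∧ csstMap i y = z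

lemma isCorner_word (w : List (Fin 3)) {e : ℂ} (he : e = 1 ∨ e = -1) :
    IsCorner w.length (csstWord w e) := by
  induction w with
  | nil => exact he
  | cons i w ih => exact ⟨i, _, ih, rfl⟩

lemma IsCorner.mem_hull {n : ℕ} {z : ℂ} (h : IsCorner n z) : z ∈ hull := by
  induction n generalizing z with
  | zero =>
    rcases h with rfl | rfl
    · exact one_mem_hull
    · exact neg_one_mem_hull
  | succ n ih =>
    obtain ⟨i, y, hy, rfl⟩ := h
    exact map_mem_hull i y (ih hy)

lemma half_pow_succ_le (n : ℕ) : (1 / 2 : ℝ) ^ (n + 1) ≤ 1 / 2 := by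
  have : (1 / 2 : ℝ) ^ n ≤ 1 := pow_le_one₀ (by norm_num) (by norm_num)
  rw [pow_succ]; linarith

lemma dist_one_two {e z : ℂ} (he : e = 1 ∨ e = -1) (hz : z = 1 ∨ z = -1) (h : z ≠ e) :
    dist z e = 2 := by
  rcases he with rfl | rfl <;> rcases hz with rfl | rfl <;>
    first | exact absurd rfl h | (rw [dist_eq_norm]; norm_num)

lemma IsCorner.le_dist_end {n : ℕ} {z e : ℂ} (h : IsCorner n z) (he : e = 1 ∨ e = -1)
    (hne : z ≠ e) : (1 / 2 : ℝ) ^ n ≤ dist z e := by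
  induction n generalizing z with
  | zero => rw [dist_one_two he h hne]; norm_num
  | succ n ih =>
    obtain ⟨i, y, hy, rfl⟩ := h
    rcases map_eq_or_half_le i he with hi | hi
    · have hye : y ≠ e := by rintro rfl; exact hne hi
      have := ih hy hye
      rw [← hi, dist_map, pow_succ]; linarith
    · exact (half_pow_succ_le n).trans (hi y hy.mem_hull)

lemma norm_map (i : Fin 3) (z : ℂ) : ‖csstMap i z‖ = dist z (root i) / 2 := by
  rw [← dist_map i, map_root, dist_zero_right]

lemma IsCorner.le_dist {n : ℕ} {z w : ℂ} (hz : IsCorner n z) (hw : IsCorner n w)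
    (hne : z ≠ w) : (1 / 2 : ℝ) ^ n / 8 ≤ dist z w := by
  induction n generalizing z w with
  | zero => rw [dist_one_two hw hz hne]; norm_num
  | succ n ih =>
    obtain ⟨i, a, ha, rfl⟩ := hz
    obtain ⟨j, b, hb, rfl⟩ := hw
    by_cases hij : i = j
    · subst hij
      have := ih ha hb (fun h => hne (by rw [h]))
      rw [dist_map, pow_succ]; linarith
    · by_cases har : a = root i
      · have hbr : b ≠ root j := by
          rintro rfl
          exact hne (by rw [har, map_root, map_root])
        have h1 := hb.le_dist_end (root_eq j) hbr
        have h2 := norm_le_of_mem_hull (Ne.symm hij) hb.mem_hull ha.mem_hull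
        rw [norm_map, dist_comm (csstMap j b)] at h2
        rw [pow_succ]; linarith
      · have h1 := ha.le_dist_end (root_eq i) har
        have h2 := norm_le_of_mem_hull hij ha.mem_hull hb.mem_hull
        rw [norm_map] at h2
        rw [pow_succ]; linarith

lemma le_dist_word_zero_end (w : List (Fin 3)) {e : ℂ} (he : e = 1 ∨ e = -1) :
    (1 / 2 : ℝ) ^ w.length ≤ dist (csstWord w 0) e := by
  induction w with
  | nil => rcases he with rfl | rfl <;> simp [csstWord]
  | cons i w ih =>
    simp only [csstWord, Function.comp, List.length_cons]
    rcases map_eq_or_half_le i he with hi | hi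
    · have h := dist_map i (csstWord w 0) e
      rw [hi] at h
      rw [h, pow_succ]; linarith
    · exact (half_pow_succ_le _).trans (hi _ (word_mem_hull w zero_mem_hull))

lemma word_zero_ne_end (w : List (Fin 3)) {e : ℂ} (he : e = 1 ∨ e = -1) :
    csstWord w 0 ≠ e := by
  intro h
  have := le_dist_word_zero_end w he
  rw [h, dist_self] at this
  have : (0 : ℝ) < (1 / 2) ^ w.length := by positivity
  linarith

section Attractor

variable {T : Set ℂ}

lemma exists_preimage (hT : IsCSST T) {x : ℂ} (hx : x ∈ T) : ∃ i, ∃ y ∈ T, csstMap i y = x := by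
  have h := hT.2.2
  rw [h] at hx
  rcases hx with (⟨y, hy, rfl⟩ | ⟨y, hy, rfl⟩) | ⟨y, hy, rfl⟩
  · exact ⟨0, y, hy, rfl⟩
  · exact ⟨1, y, hy, rfl⟩
  · exact ⟨2, y, hy, rfl⟩

lemma map_mem (hT : IsCSST T) (i : Fin 3) (y : ℂ) (hy : y ∈ T) : csstMap i y ∈ T := by
  have h := hT.2.2
  rw [h]
  fin_cases i
  · exact Or.inl (Or.inl ⟨y, hy, rfl⟩)
  · exact Or.inl (Or.inr ⟨y, hy, rfl⟩)
  · exact Or.inr ⟨y, hy, rfl⟩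

lemma word_mem (hT : IsCSST T) (w : List (Fin 3)) {y : ℂ} (hy : y ∈ T) : csstWord w y ∈ T := by
  induction w with
  | nil => exact hy
  | cons i w ih => exact map_mem hT i _ ih

lemma subset_hull (hT : IsCSST T) : T ⊆ hull :=
  subset_of_invariant hT.2.1.isBounded isClosed_hull ⟨0, zero_mem_hull⟩
    (fun _ hx => exists_preimage hT hx) map_mem_hull

lemma dist_le_four (hT : IsCSST T) {x y : ℂ} (hx : x ∈ T) (hy : y ∈ T) : dist x y ≤ 4 := by
  have h1 := norm_le_two_of_mem_hull (subset_hull hT hx)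
  have h2 := norm_le_two_of_mem_hull (subset_hull hT hy)
  have := dist_le_norm_add_norm x y
  linarith

lemma segment_subset (hT : IsCSST T) : (fun t : ℝ => (t : ℂ)) '' Set.Icc (-1) 1 ⊆ T := by
  refine subset_of_invariant (isCompact_Icc.image Complex.continuous_ofReal).isBounded
    hT.2.1.isClosed hT.1 ?_ (map_mem hT)
  rintro _ ⟨t, ⟨h1, h2⟩, rfl⟩
  rcases le_total t 0 with h | h
  · refine ⟨0, _, ⟨2 * t + 1, ⟨by linarith, by linarith⟩, rfl⟩, ?_⟩
    apply Complex.ext <;> simp; ring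
  · refine ⟨1, _, ⟨2 * t - 1, ⟨by linarith, by linarith⟩, rfl⟩, ?_⟩
    apply Complex.ext <;> simp; ring

lemma end_mem_segment {e : ℂ} (he : e = 1 ∨ e = -1) :
    e ∈ (fun t : ℝ => (t : ℂ)) '' Set.Icc (-1) 1 := by
  rcases he with rfl | rfl
  · exact ⟨1, by norm_num, by simp⟩
  · exact ⟨-1, by norm_num, by simp⟩

lemma end_mem (hT : IsCSST T) {e : ℂ} (he : e = 1 ∨ e = -1) : e ∈ T :=
  segment_subset hT (end_mem_segment he)

lemma zero_mem_segment : (0 : ℂ) ∈ (fun t : ℝ => (t : ℂ)) '' Set.Icc (-1) 1 :=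
  ⟨0, by norm_num, by simp⟩

lemma zero_mem (hT : IsCSST T) : (0 : ℂ) ∈ T := segment_subset hT zero_mem_segment

lemma isPreconnected (hT : IsCSST T) : IsPreconnected T := by
  have h0 := zero_mem hT
  have hseg : (fun t : ℝ => (t : ℂ)) '' Set.Icc (-1) 1 ⊆ connectedComponentIn T 0 :=
    (isPreconnected_Icc.image _ Complex.continuous_ofReal.continuousOn).subset_connectedComponentIn
      zero_mem_segment (segment_subset hT)
  have hc : IsClosed (connectedComponentIn T 0) := by
    apply isClosed_of_closure_subset
    exact isPreconnected_connectedComponentIn.closure.subset_connectedComponentIn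
      (subset_closure (mem_connectedComponentIn h0))
      (closure_minimal (connectedComponentIn_subset _ _) hT.2.1.isClosed)
  have hsub : T ⊆ connectedComponentIn T 0 := by
    refine subset_of_invariant hT.2.1.isBounded hc ⟨0, mem_connectedComponentIn h0⟩
      (fun _ hx => exists_preimage hT hx) ?_
    intro i y hy
    have h1 : IsPreconnected (csstMap i '' connectedComponentIn T 0) :=
      isPreconnected_connectedComponentIn.image _ (continuous_map i).continuousOn
    refine h1.subset_connectedComponentIn
      ⟨root i, hseg (end_mem_segment (root_eq i)), map_root i⟩ ?_ ⟨y, hy, rfl⟩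
    rintro _ ⟨z, hz, rfl⟩
    exact map_mem hT i z (connectedComponentIn_subset _ _ hz)
  rw [hsub.antisymm (connectedComponentIn_subset _ _)]
  exact isPreconnected_connectedComponentIn

lemma eq_root_of_map_eq (hT : IsCSST T) {i j : Fin 3} (hij : i ≠ j) {a b : ℂ} (ha : a ∈ T)
    (hb : b ∈ T) (h : csstMap i a = csstMap j b) : a = root i := by
  have := norm_le_of_mem_hull hij (subset_hull hT ha) (subset_hull hT hb)
  rw [h, dist_self, ← h, norm_map] at this
  exact dist_le_zero.1 (by linarith)

lemma eq_end_of_word_eq_end (hT : IsCSST T) (w : List (Fin 3)) {a e : ℂ} (ha : a ∈ T)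
    (he : e = 1 ∨ e = -1) (h : csstWord w a = e) : a = 1 ∨ a = -1 := by
  induction w with
  | nil => subst h; exact he
  | cons i w ih =>
    rcases map_eq_or_half_le i he with hi | hi
    · exact ih (map_injective i (h.trans hi.symm))
    · have := hi _ (subset_hull hT (word_mem hT w ha))
      change csstMap i (csstWord w a) = e at h
      rw [h, dist_self] at this
      norm_num at this

/-- Any point outside the piece `g_w(T)` is joined to a corner of that piece by a connected
set meeting the piece only in corners. -/
lemma exists_connected_to_corner (hT : IsCSST T) (w : List (Fin 3)) {x : ℂ} (hx : x ∈ T)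
    (hxw : x ∉ csstWord w '' T) :
    ∃ S ⊆ T, IsPreconnected S ∧ x ∈ S ∧ (csstWord w 1 ∈ S ∨ csstWord w (-1) ∈ S) ∧
      ∀ a ∈ T, csstWord w a ∈ S → a = 1 ∨ a = -1 := by
  induction w generalizing x with
  | nil => exact absurd ⟨x, hx, rfl⟩ hxw
  | cons i w ih =>
    have lift : ∀ y ∈ T, y ∉ csstWord w '' T →
        ∃ S ⊆ csstMap i '' T, IsPreconnected S ∧ csstMap i y ∈ S ∧
          (csstWord (i :: w) 1 ∈ S ∨ csstWord (i :: w) (-1) ∈ S) ∧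
          ∀ a ∈ T, csstWord (i :: w) a ∈ S → a = 1 ∨ a = -1 := by
      intro y hy hyw
      obtain ⟨S, hST, hS, hyS, hc, ha⟩ := ih hy hyw
      refine ⟨csstMap i '' S, Set.image_mono hST, hS.image _ (continuous_map i).continuousOn,
        ⟨y, hyS, rfl⟩, hc.imp (fun h => ⟨_, h, rfl⟩) (fun h => ⟨_, h, rfl⟩), ?_⟩
      rintro a haT ⟨s, hs, hsa⟩
      have := map_injective i hsa
      exact ha a haT (this ▸ hs)
    have hiT : csstMap i '' T ⊆ T := by rintro _ ⟨z, hz, rfl⟩; exact map_mem hT i z hz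
    obtain ⟨j, y, hy, rfl⟩ := exists_preimage hT hx
    by_cases hij : j = i
    · subst hij
      have hyw : y ∉ csstWord w '' T := by
        rintro ⟨z, hz, rfl⟩; exact hxw ⟨z, hz, rfl⟩
      obtain ⟨S, hS, h⟩ := lift y hy hyw
      exact ⟨S, hS.trans hiT, h⟩
    · have hjT : csstMap j '' T ⊆ T := by rintro _ ⟨z, hz, rfl⟩; exact map_mem hT j z hz
      have hjc : IsPreconnected (csstMap j '' T) :=
        (isPreconnected hT).image _ (continuous_map j).continuousOn
      have h0 : (0 : ℂ) ∈ csstMap j '' T := ⟨root j, end_mem hT (root_eq j), map_root j⟩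
      have hcorner : ∀ a ∈ T, csstWord (i :: w) a ∈ csstMap j '' T → a = 1 ∨ a = -1 := by
        rintro a ha ⟨z, hz, hza⟩
        have := eq_root_of_map_eq hT (Ne.symm hij) (word_mem hT w ha) hz hza.symm
        exact eq_end_of_word_eq_end hT w ha (root_eq i) this
      by_cases hr : root i ∈ csstWord w '' T
      · obtain ⟨a, ha, har⟩ := hr
        have h0a : csstWord (i :: w) a = 0 := by
          simp only [csstWord, Function.comp, har, map_root]
        refine ⟨_, hjT, hjc, ⟨y, hy, rfl⟩, ?_, hcorner⟩
        rcases eq_end_of_word_eq_end hT w ha (root_eq i) har with rfl | rfl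
        · left; rw [h0a]; exact h0
        · right; rw [h0a]; exact h0
      · obtain ⟨S, hST, hS, h0S, hc, ha⟩ := lift _ (end_mem hT (root_eq i)) hr
        rw [map_root] at h0S
        refine ⟨csstMap j '' T ∪ S, Set.union_subset hjT (hST.trans hiT),
          hjc.union 0 h0 h0S hS, Or.inl ⟨y, hy, rfl⟩, hc.imp Or.inr Or.inr, ?_⟩
        rintro a haT (h | h)
        · exact hcorner a haT h
        · exact ha a haT h

lemma diam_le_of_subset_word (hT : IsCSST T) (w : List (Fin 3)) {B : Set ℂ}
    (hB : B ⊆ csstWord w '' T) : Metric.diam B ≤ 4 * (1 / 2) ^ w.length := by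
  apply Metric.diam_le_of_forall_dist_le (by positivity)
  intro x hx y hy
  obtain ⟨a, ha, rfl⟩ := hB hx
  obtain ⟨b, hb, rfl⟩ := hB hy
  rw [dist_word]
  exact mul_le_mul_of_nonneg_right (dist_le_four hT ha hb) (by positivity)

lemma exists_word (hT : IsCSST T) (n : ℕ) {x : ℂ} (hx : x ∈ T) :
    ∃ w : List (Fin 3), w.length = n ∧ x ∈ csstWord w '' T := by
  induction n generalizing x with
  | zero => exact ⟨[], rfl, x, hx, rfl⟩
  | succ n ih =>
    obtain ⟨i, y, hy, rfl⟩ := exists_preimage hT hx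
    obtain ⟨w, hw, a, ha, rfl⟩ := ih hy
    exact ⟨i :: w, by simp [hw], a, ha, rfl⟩

lemma component_eq_of_mem {X : Type*} [TopologicalSpace X] {S : Set X} {x y z : X}
    (hx : z ∈ connectedComponentIn S x) (hy : z ∈ connectedComponentIn S y) :
    connectedComponentIn S x = connectedComponentIn S y :=
  (connectedComponentIn_eq hx).trans (connectedComponentIn_eq hy).symm

lemma heightIn_le_of_not_isCorner (hT : IsCSST T) {n : ℕ} {p : ℂ} (hp : p ∈ T)
    (hn : ¬ IsCorner n p) : heightIn T p ≤ 4 * (1 / 2) ^ n := by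
  obtain ⟨w, rfl, a, ha, rfl⟩ := exists_word hT n hp
  have ha' : ¬ (a = 1 ∨ a = -1) := fun h => hn (isCorner_word w h)
  have hcl : IsClosed (csstWord w '' T) := (hT.2.1.image (continuous_word w)).isClosed
  have key : ∀ q ∈ T \ {csstWord w a},
      closure (connectedComponentIn (T \ {csstWord w a}) q) ⊆ csstWord w '' T ∨
      csstWord w 1 ∈ connectedComponentIn (T \ {csstWord w a}) q ∨
      csstWord w (-1) ∈ connectedComponentIn (T \ {csstWord w a}) q := by
    intro q hq
    by_cases hsub : connectedComponentIn (T \ {csstWord w a}) q ⊆ csstWord w '' T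
    · exact Or.inl (closure_minimal hsub hcl)
    · right
      obtain ⟨x, hx, hxw⟩ := Set.not_subset.1 hsub
      have hxT := connectedComponentIn_subset _ _ hx
      obtain ⟨S, hST, hS, hxS, hc, hcor⟩ := exists_connected_to_corner hT w hxT.1 hxw
      have hS2 : S ⊆ connectedComponentIn (T \ {csstWord w a}) q := by
        rw [connectedComponentIn_eq hx]
        refine hS.subset_connectedComponentIn hxS fun s hs => ⟨hST hs, ?_⟩
        rintro rfl
        exact ha' (hcor a ha hs)
      exact hc.imp (fun h => hS2 h) (fun h => hS2 h)
  refine Real.sSup_le ?_ (by positivity)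
  rintro r ⟨B₁, B₂, B₃, ⟨q₁, h₁, rfl⟩, ⟨q₂, h₂, rfl⟩, ⟨q₃, h₃, rfl⟩, n₁₂, n₁₃, n₂₃, rfl⟩
  have e : ∀ {q q' c : ℂ}, closure (connectedComponentIn (T \ {csstWord w a}) q) ≠
      closure (connectedComponentIn (T \ {csstWord w a}) q') →
      c ∈ connectedComponentIn (T \ {csstWord w a}) q →
      c ∉ connectedComponentIn (T \ {csstWord w a}) q' :=
    fun hne h h' => hne (by rw [component_eq_of_mem h h'])
  rcases key q₁ h₁ with k₁ | k₁
  · exact (min_le_left _ _).trans (diam_le_of_subset_word hT w k₁)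
  rcases key q₂ h₂ with k₂ | k₂
  · exact (min_le_right _ _).trans ((min_le_left _ _).trans (diam_le_of_subset_word hT w k₂))
  rcases key q₃ h₃ with k₃ | k₃
  · exact (min_le_right _ _).trans ((min_le_right _ _).trans (diam_le_of_subset_word hT w k₃))
  exfalso
  rcases k₁ with k₁ | k₁ <;> rcases k₂ with k₂ | k₂ <;> rcases k₃ with k₃ | k₃ <;>
    first
      | exact e n₁₂ k₁ k₂
      | exact e n₁₃ k₁ k₃
      | exact e n₂₃ k₂ k₃

lemma branch_subset (hT : IsCSST T) {p : ℂ} {B : Set ℂ} (hB : IsBranchIn T p B) : B ⊆ T := by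
  obtain ⟨q, -, rfl⟩ := hB
  exact closure_minimal ((connectedComponentIn_subset _ _).trans Set.sdiff_subset)
    hT.2.1.isClosed

lemma min_diam_le_four (hT : IsCSST T) (p : ℂ) :
    4 ∈ upperBounds {r : ℝ | ∃ B₁ B₂ B₃ : Set ℂ, IsBranchIn T p B₁ ∧ IsBranchIn T p B₂ ∧
      IsBranchIn T p B₃ ∧ B₁ ≠ B₂ ∧ B₁ ≠ B₃ ∧ B₂ ≠ B₃ ∧
      r = min (Metric.diam B₁) (min (Metric.diam B₂) (Metric.diam B₃))} := by
  rintro r ⟨B₁, B₂, B₃, h₁, -, -, -, -, -, rfl⟩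
  exact (min_le_left _ _).trans (Metric.diam_le_of_forall_dist_le (by norm_num)
    fun x hx y hy => dist_le_four hT (branch_subset hT h₁ hx) (branch_subset hT h₁ hy))

lemma heightIn_le_four (hT : IsCSST T) (p : ℂ) : heightIn T p ≤ 4 :=
  Real.sSup_le (fun _ hr => min_diam_le_four hT p hr) (by norm_num)

/-- `T` splits into three closed sets that pairwise meet at most in `g_w(0)` and contain
the three pieces of `g_w(T)` respectively. -/
lemma exists_splitting (hT : IsCSST T) (w : List (Fin 3)) :
    ∃ C : Fin 3 → Set ℂ, (∀ i, IsClosed (C i)) ∧ (∀ i, C i ⊆ T) ∧ (∀ x ∈ T, ∃ i, x ∈ C i) ∧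
      (∀ i j, i ≠ j → ∀ x ∈ C i, x ∈ C j → x = csstWord w 0) ∧
      ∀ i, ∀ a ∈ T, csstWord w (csstMap i a) ∈ C i := by
  have hc : ∀ {K : Set ℂ} (i : Fin 3), K ⊆ T → IsClosed K → IsClosed (csstMap i '' K) :=
    fun i hK hKc => ((hT.2.1.of_isClosed_subset hKc hK).image (continuous_map i)).isClosed
  induction w with
  | nil =>
    refine ⟨fun i => csstMap i '' T, fun i => hc i subset_rfl hT.2.1.isClosed, ?_, ?_, ?_, ?_⟩
    · rintro i _ ⟨a, ha, rfl⟩; exact map_mem hT i a ha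
    · intro x hx
      obtain ⟨i, y, hy, rfl⟩ := exists_preimage hT hx
      exact ⟨i, y, hy, rfl⟩
    · rintro i j hij _ ⟨a, ha, rfl⟩ ⟨b, hb, hab⟩
      rw [eq_root_of_map_eq hT hij ha hb hab.symm, map_root]; rfl
    · intro i a ha; exact ⟨a, ha, rfl⟩
  | cons k w ih =>
    obtain ⟨C, hCc, hCT, hcov, hdisj, hw⟩ := ih
    obtain ⟨m, hm⟩ := hcov (root k) (end_mem hT (root_eq k))
    have hm' : ∀ i, root k ∈ C i → i = m := by
      intro i hi
      by_contra hne
      exact word_zero_ne_end w (root_eq k) (hdisj i m hne _ hi hm).symm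
    have aux : ∀ i, i ≠ m → ∀ x ∈ csstMap k '' C i, ∀ l, l ≠ k → x ∉ csstMap l '' T := by
      rintro i hi _ ⟨a, ha, rfl⟩ l hl ⟨b, hb, hab⟩
      have := eq_root_of_map_eq hT (Ne.symm hl) (hCT i ha) hb hab.symm
      exact hi (hm' i (this ▸ ha))
    refine ⟨fun i => csstMap k '' C i ∪ {x | i = m ∧ ∃ l, l ≠ k ∧ x ∈ csstMap l '' T},
      ?_, ?_, ?_, ?_, ?_⟩
    · intro i
      refine (hc k (hCT i) (hCc i)).union ?_
      by_cases hi : i = m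
      · have : {x | i = m ∧ ∃ l, l ≠ k ∧ x ∈ csstMap l '' T} =
            ⋃ l ∈ {l : Fin 3 | l ≠ k}, csstMap l '' T := by
          ext x; simp [hi]
        rw [this]
        exact (Set.toFinite _).isClosed_biUnion fun l _ => hc l subset_rfl hT.2.1.isClosed
      · simp [hi]
    · rintro i _ (⟨a, ha, rfl⟩ | ⟨-, l, -, a, ha, rfl⟩)
      · exact map_mem hT k a (hCT i ha)
      · exact map_mem hT l a ha
    · intro x hx
      obtain ⟨l, y, hy, rfl⟩ := exists_preimage hT hx
      by_cases hl : l = k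
      · subst hl
        obtain ⟨i, hi⟩ := hcov y hy
        exact ⟨i, Or.inl ⟨y, hi, rfl⟩⟩
      · exact ⟨m, Or.inr ⟨rfl, l, hl, y, hy, rfl⟩⟩
    · rintro i j hij x (h | ⟨him, l, hl, h⟩) (h' | ⟨hjm, l', hl', h'⟩)
      · obtain ⟨a, ha, rfl⟩ := h
        obtain ⟨b, hb, hab⟩ := h'
        have := map_injective k hab
        subst this
        rw [hdisj i j hij _ ha hb]; rfl
      · exact absurd h' (aux i (fun h => hij (h.trans hjm.symm)) x h l' hl')
      · exact absurd h (aux j (fun h => hij (him.trans h.symm)) x h' l hl)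
      · exact absurd (him.trans hjm.symm) hij
    · intro i a ha
      exact Or.inl ⟨_, hw i a ha, rfl⟩

lemma index_eq_of_isPreconnected {C : Fin 3 → Set ℂ} {p : ℂ} (hCc : ∀ i, IsClosed (C i))
    (hcov : ∀ x ∈ T, ∃ i, x ∈ C i) (hdisj : ∀ i j, i ≠ j → ∀ x ∈ C i, x ∈ C j → x = p)
    {S : Set ℂ} (hST : S ⊆ T) (hS : IsPreconnected S) (hpS : p ∉ S) {i : Fin 3} {x : ℂ}
    (hx : x ∈ S) (hxi : x ∈ C i) : S ⊆ C i := by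
  intro y hy
  by_contra hyi
  obtain ⟨j, hj⟩ := hcov y (hST hy)
  have hji : j ≠ i := by rintro rfl; exact hyi hj
  obtain ⟨z, hzS, hz1, hz2⟩ := isPreconnected_closed_iff.1 hS (C i)
    (⋃ l ∈ {l : Fin 3 | l ≠ i}, C l) (hCc i)
    ((Set.toFinite _).isClosed_biUnion fun l _ => hCc l)
    (fun z hz => by
      obtain ⟨l, hl⟩ := hcov z (hST hz)
      by_cases h : l = i
      · exact Or.inl (h ▸ hl)
      · exact Or.inr (Set.mem_biUnion h hl))
    ⟨x, hx, hxi⟩ ⟨y, hy, Set.mem_biUnion hji hj⟩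
  obtain ⟨l, hl, hzl⟩ := Set.mem_iUnion₂.1 hz2
  rw [hdisj l i hl z hzl hz1] at hzS
  exact hpS hzS

lemma exists_branches (hT : IsCSST T) (w : List (Fin 3)) :
    ∃ B : Fin 3 → Set ℂ, (∀ i, IsBranchIn T (csstWord w 0) (B i)) ∧
      (∀ i j, i ≠ j → B i ≠ B j) ∧ ∀ i, (1 / 2 : ℝ) ^ w.length / 2 ≤ Metric.diam (B i) := by
  obtain ⟨C, hCc, hCT, hcov, hdisj, hw⟩ := exists_splitting hT w
  set p := csstWord w 0 with hp
  set c : Fin 3 → ℂ → ℂ := fun i z => csstWord w (csstMap i z) with hcdef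
  have hcp : ∀ i z, z ≠ root i → c i z ≠ p := by
    intro i z hz h
    have := word_injective w h
    rw [← map_root i] at this
    exact hz (map_injective i this)
  have h0r : ∀ i, (0 : ℂ) ≠ root i := by
    intro i h; rcases root_eq i with h' | h' <;> rw [h'] at h <;> norm_num at h
  have hmem : ∀ i, c i 0 ∈ T \ {p} := fun i =>
    ⟨word_mem hT w (map_mem hT i 0 (zero_mem hT)), hcp i 0 (h0r i)⟩
  have hsub : ∀ i, closure (connectedComponentIn (T \ {p}) (c i 0)) ⊆ C i := by
    intro i
    refine closure_minimal (index_eq_of_isPreconnected hCc hcov hdisj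
      ((connectedComponentIn_subset _ _).trans Set.sdiff_subset)
      isPreconnected_connectedComponentIn ?_ (mem_connectedComponentIn (hmem i))
      (hw i 0 (zero_mem hT))) (hCc i)
    exact fun h => (connectedComponentIn_subset _ _ h).2 rfl
  refine ⟨fun i => closure (connectedComponentIn (T \ {p}) (c i 0)),
    fun i => ⟨_, hmem i, rfl⟩, ?_, ?_⟩
  · intro i j hij h
    have h1 : c i 0 ∈ C j := by
      apply hsub j
      refine h.subset ?_
      exact subset_closure (mem_connectedComponentIn (hmem i))
    exact (hmem i).2 (hdisj i j hij _ (hw i 0 (zero_mem hT)) h1)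
  · intro i
    have hcont : Continuous (fun t : ℝ => c i (-(t : ℂ) * root i)) :=
      (continuous_word w).comp ((continuous_map i).comp (by fun_prop))
    have hsegT : ∀ t ∈ Set.Icc (0 : ℝ) 1, -(t : ℂ) * root i ∈ T := by
      intro t ht
      apply segment_subset hT
      rcases root_eq i with h | h <;> rw [h]
      · exact ⟨-t, ⟨by linarith [ht.2], by linarith [ht.1]⟩, by simp⟩
      · exact ⟨t, ⟨by linarith [ht.1], ht.2⟩, by simp⟩
    have hne : ∀ t ∈ Set.Icc (0 : ℝ) 1, -(t : ℂ) * root i ≠ root i := by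
      intro t ht h
      have := congrArg Complex.re h
      rcases root_eq i with h' | h' <;> rw [h'] at this <;> simp at this <;> linarith [ht.1]
    have himg : (fun t : ℝ => c i (-(t : ℂ) * root i)) '' Set.Icc 0 1 ⊆
        connectedComponentIn (T \ {p}) (c i 0) := by
      refine (isPreconnected_Icc.image _ hcont.continuousOn).subset_connectedComponentIn
        ⟨0, by norm_num, by simp⟩ ?_
      rintro _ ⟨t, ht, rfl⟩
      exact ⟨word_mem hT w (map_mem hT i _ (hsegT t ht)), hcp i _ (hne t ht)⟩
    have h1 : c i (-root i) ∈ connectedComponentIn (T \ {p}) (c i 0) :=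
      himg ⟨1, by norm_num, by simp⟩
    have hb : Bornology.IsBounded (closure (connectedComponentIn (T \ {p}) (c i 0))) :=
      hT.2.1.isBounded.subset ((hsub i).trans (hCT i))
    have := Metric.dist_le_diam_of_mem hb
      (subset_closure (mem_connectedComponentIn (hmem i))) (subset_closure h1)
    refine le_trans (le_of_eq ?_) this
    rw [hcdef, dist_word, dist_map]
    rcases root_eq i with h | h <;> rw [h] <;> simp <;> ring

lemma isBranchPointIn_word_zero (hT : IsCSST T) (w : List (Fin 3)) :
    IsBranchPointIn T (csstWord w 0) := by
  obtain ⟨B, hB, hne, -⟩ := exists_branches hT w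
  exact ⟨B 0, B 1, B 2, hB 0, hB 1, hB 2, hne _ _ (by decide), hne _ _ (by decide),
    hne _ _ (by decide)⟩

lemma le_heightIn_word_zero (hT : IsCSST T) (w : List (Fin 3)) :
    (1 / 2 : ℝ) ^ w.length / 2 ≤ heightIn T (csstWord w 0) := by
  obtain ⟨B, hB, hne, hd⟩ := exists_branches hT w
  refine le_trans (le_min (hd 0) (le_min (hd 1) (hd 2)))
    (le_csSup ⟨4, min_diam_le_four hT _⟩ ?_)
  exact ⟨B 0, B 1, B 2, hB 0, hB 1, hB 2, hne _ _ (by decide), hne _ _ (by decide),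
    hne _ _ (by decide), rfl⟩

/-- Distinct points of `T` are separated by a finite word. -/
lemma exists_separating_word (hT : IsCSST T) (n : ℕ) {x y : ℂ} (hx : x ∈ T) (hy : y ∈ T)
    (h : 4 * (1 / 2 : ℝ) ^ n < dist x y) :
    ∃ (w : List (Fin 3)) (i j : Fin 3), i ≠ j ∧ ∃ a ∈ T, ∃ b ∈ T,
      x = csstWord w (csstMap i a) ∧ y = csstWord w (csstMap j b) := by
  induction n generalizing x y with
  | zero => linarith [dist_le_four hT hx hy]
  | succ n ih =>
    obtain ⟨i, a, ha, rfl⟩ := exists_preimage hT hx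
    obtain ⟨j, b, hb, rfl⟩ := exists_preimage hT hy
    by_cases hij : i = j
    · subst hij
      rw [dist_map, pow_succ] at h
      obtain ⟨w, k, l, hkl, a', ha', b', hb', rfl, rfl⟩ := ih ha hb (by linarith)
      exact ⟨i :: w, k, l, hkl, a', ha', b', hb', rfl, rfl⟩
    · exact ⟨[], i, j, hij, a, ha, b, hb, rfl, rfl⟩

lemma isPreconnected_of_isArc {A : Set ℂ} {x y : ℂ} (h : IsArc A x y) :
    IsPreconnected A ∧ x ∈ A ∧ y ∈ A := by
  rcases h with ⟨rfl, rfl⟩ | ⟨-, f, hf, -, rfl, rfl, rfl⟩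
  · exact ⟨isPreconnected_singleton, rfl, rfl⟩
  · exact ⟨isPreconnected_Icc.image f hf, ⟨0, by norm_num, rfl⟩, ⟨1, by norm_num, rfl⟩⟩

lemma min_heightIn_le (hT : IsCSST T) {p q : ℂ} (hp : p ∈ T) (hq : q ∈ T) (hpq : p ≠ q) :
    min (heightIn T p) (heightIn T q) ≤ 128 * dist p q := by
  have hd : 0 < dist p q := dist_pos.2 hpq
  rcases le_or_gt (16 * dist p q) 1 with h | h
  · obtain ⟨n, h1, h2⟩ := exists_nat_pow_near_of_lt_one (y := (1 / 2 : ℝ))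
      (by linarith : 0 < 16 * dist p q) h (by norm_num) (by norm_num)
    rw [pow_succ] at h1
    by_cases hpn : IsCorner n p
    · by_cases hqn : IsCorner n q
      · linarith [hpn.le_dist hqn hpq]
      · refine (min_le_right _ _).trans ((heightIn_le_of_not_isCorner hT hq hqn).trans ?_)
        linarith
    · refine (min_le_left _ _).trans ((heightIn_le_of_not_isCorner hT hp hpn).trans ?_)
      linarith
  · refine (min_le_left _ _).trans ((heightIn_le_four hT p).trans ?_)
    linarith

lemma exists_branchPoint_mem (hT : IsCSST T) {x y : ℂ} (hx : x ∈ T) (hy : y ∈ T)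
    (hxy : x ≠ y) {A : Set ℂ} (hAT : A ⊆ T) (hA : IsPreconnected A) (hxA : x ∈ A)
    (hyA : y ∈ A) : ∃ p ∈ A, IsBranchPointIn T p ∧ dist x y ≤ 8 * heightIn T p := by
  have hd : 0 < dist x y / 4 := by have := dist_pos.2 hxy; linarith
  obtain ⟨n, hn⟩ := exists_pow_lt_of_lt_one hd (by norm_num : (1 / 2 : ℝ) < 1)
  obtain ⟨w, i, j, hij, a, ha, b, hb, rfl, rfl⟩ :=
    exists_separating_word hT n hx hy (by linarith)
  refine ⟨csstWord w 0, ?_, isBranchPointIn_word_zero hT w, ?_⟩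
  · by_contra hpA
    obtain ⟨C, hCc, hCT, hcov, hdisj, hw⟩ := exists_splitting hT w
    have h1 := index_eq_of_isPreconnected hCc hcov hdisj hAT hA hpA hxA (hw i a ha) hyA
    exact hpA (hdisj i j hij _ h1 (hw j b hb) ▸ hyA)
  · have h1 := le_heightIn_word_zero hT w
    have h2 := dist_le_four hT (map_mem hT i a ha) (map_mem hT j b hb)
    rw [dist_word]
    have h3 := mul_le_mul_of_nonneg_right h2 (by positivity : (0 : ℝ) ≤ (1 / 2) ^ w.length)
    linarith

end Attractor

end CSST

theorem stmt18 (T : Set ℂ) (hT : IsCSST T) :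
    ∃ C : ℝ, 1 ≤ C ∧
      -- (a) branch points of `T` are uniformly relatively separated
      (∀ p q : ℂ, p ∈ T → q ∈ T → IsBranchPointIn T p → IsBranchPointIn T q →
        p ≠ q → min (heightIn T p) (heightIn T q) / C ≤ dist p q) ∧
      -- (b) branch points of `T` are uniformly relatively dense: on the unique
      -- arc `A ⊆ T` joining distinct `x, y ∈ T` there is a branch point `p`
      -- with `H_T(p) ≥ |x - y| / C`
      (∀ x y : ℂ, x ∈ T → y ∈ T → x ≠ y → ∀ A : Set ℂ, A ⊆ T → IsArc A x y →
        ∃ p ∈ A, IsBranchPointIn T p ∧ dist x y / C ≤ heightIn T p) := by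
  refine ⟨128, by norm_num, ?_, ?_⟩
  · intro p q hp hq _ _ hpq
    have := CSST.min_heightIn_le hT hp hq hpq
    rw [div_le_iff₀ (by norm_num)]
    linarith
  · intro x y hx hy hxy A hAT hA
    obtain ⟨hAc, hxA, hyA⟩ := CSST.isPreconnected_of_isArc hA
    obtain ⟨p, hpA, hbp, hh⟩ := CSST.exists_branchPoint_mem hT hx hy hxy hAT hAc hxA hyA
    refine ⟨p, hpA, hbp, ?_⟩
    rw [div_le_iff₀ (by norm_num)]
    linarith [dist_pos.2 hxy]
end

section
/- Let T be the continuum self-similar tree, V ⊂ T a finite set of branch points of T, and X the set of tiles of the decomposition of T induced by V (closures of components of T \ V). Suppose every tile in X is of the form g_w(T) for a finite word w over {1,2,3}. Then ℓ(X) ≤ #V for every X ∈ X, where ℓ(X) is the length of the word w with X = g_w(T); and if V ≠ ∅, then ℓ(X) ≥ 1 for every X ∈ X. -/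
open Complex

/-- `X` is a tile of the decomposition of `T` induced by `V`: the closure of a
connected component of `T \ V`. -/
def IsTileOf (T V X : Set ℂ) : Prop :=
  ∃ q ∈ T \ V, X = closure (connectedComponentIn (T \ V) q)

lemma csstMap_zero_re (z : ℂ) : (csstMap 0 z).re = z.re / 2 - 1 / 2 := by
  simp [csstMap]

lemma csstMap_zero_im (z : ℂ) : (csstMap 0 z).im = z.im / 2 := by
  simp [csstMap]

lemma csstMap_one_re (z : ℂ) : (csstMap 1 z).re = z.re / 2 + 1 / 2 := by
  simp [csstMap]

lemma csstMap_one_im (z : ℂ) : (csstMap 1 z).im = -z.im / 2 := by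
  simp [csstMap]

lemma csstMap_two_re (z : ℂ) : (csstMap 2 z).re = z.im / 2 := by
  simp [csstMap]

lemma csstMap_two_im (z : ℂ) : (csstMap 2 z).im = z.re / 2 + 1 / 2 := by
  simp [csstMap]

lemma dist_csstMap (i : Fin 3) (a b : ℂ) :
    dist (csstMap i a) (csstMap i b) = dist a b / 2 := by
  simp only [Complex.dist_eq_re_im]
  rw [eq_div_iff two_ne_zero]
  have key : ∀ x y : ℝ, x = y / 4 → √x * 2 = √y := by
    rintro x y rfl
    rw [Real.sqrt_div' _ (by norm_num), show (4 : ℝ) = 2 ^ 2 by norm_num, Real.sqrt_sq (by norm_num)]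
    ring
  apply key
  fin_cases i <;>
    simp only [Fin.zero_eta, Fin.mk_one, Fin.reduceFinMk, csstMap_zero_re, csstMap_zero_im,
      csstMap_one_re, csstMap_one_im, csstMap_two_re, csstMap_two_im] <;> ring

lemma continuous_csstMap (i : Fin 3) : Continuous (csstMap i) := by
  fin_cases i <;> simp only [csstMap] <;> dsimp <;> fun_prop

/-- The generators of the continuum self-similar tree as homeomorphisms of the plane. -/
noncomputable def csstHomeo (i : Fin 3) : ℂ ≃ₜ ℂ where
  toFun := csstMap i
  invFun := (![fun z => 2 * z + 1, fun z => (starRingEnd ℂ) (2 * z - 1),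
    fun z => (starRingEnd ℂ) (-(2 * Complex.I * z) - 1)] : Fin 3 → ℂ → ℂ) i
  left_inv z := by
    fin_cases i <;> apply Complex.ext <;>
      simp [csstMap_zero_re, csstMap_zero_im, csstMap_one_re, csstMap_one_im, csstMap_two_re,
        csstMap_two_im] <;> ring
  right_inv z := by
    fin_cases i <;> apply Complex.ext <;> simp [csstMap] <;> ring
  continuous_toFun := continuous_csstMap i
  continuous_invFun := by
    fin_cases i <;> dsimp <;> fun_prop

lemma coe_csstHomeo (i : Fin 3) : ⇑(csstHomeo i) = csstMap i := rfl

lemma csstMap_injective (i : Fin 3) : Function.Injective (csstMap i) :=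
  (csstHomeo i).injective

lemma continuous_csstWord (w : List (Fin 3)) : Continuous (csstWord w) := by
  induction w with
  | nil => exact continuous_id
  | cons i w ih => exact (continuous_csstMap i).comp ih

lemma dist_csstWord (w : List (Fin 3)) (a b : ℂ) :
    dist (csstWord w a) (csstWord w b) = dist a b / 2 ^ w.length := by
  induction w with
  | nil => simp [csstWord]
  | cons i w ih =>
    simp only [csstWord, Function.comp_apply, dist_csstMap, ih, List.length_cons, pow_succ]
    rw [div_div]

/-- The convex quadrilateral with vertices `-1`, `1`, `i` and `(1 - i) / 2`, which the
generators of the continuum self-similar tree map into itself. -/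
def csstHull : Set ℂ :=
  {z | z.im ≤ z.re + 1 ∧ z.im ≤ 1 - z.re ∧ -1 ≤ z.re + 3 * z.im ∧ z.re - 1 ≤ z.im}

lemma isClosed_csstHull : IsClosed csstHull := by
  have hr := Complex.continuous_re
  have hi := Complex.continuous_im
  refine IsClosed.and (isClosed_le ?_ ?_) (IsClosed.and (isClosed_le ?_ ?_)
    (IsClosed.and (isClosed_le ?_ ?_) (isClosed_le ?_ ?_))) <;> fun_prop

lemma csstMap_mem_csstHull (i : Fin 3) {z : ℂ} (hz : z ∈ csstHull) :
    csstMap i z ∈ csstHull := by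
  obtain ⟨h1, h2, h3, h4⟩ := hz
  fin_cases i <;>
    simp only [csstHull, Set.mem_ofPred_eq, Fin.zero_eta, Fin.mk_one, Fin.reduceFinMk,
      csstMap_zero_re, csstMap_zero_im, csstMap_one_re, csstMap_one_im, csstMap_two_re,
      csstMap_two_im] <;>
    refine ⟨?_, ?_, ?_, ?_⟩ <;> linarith

lemma csstWord_mem_csstHull (w : List (Fin 3)) {z : ℂ} (hz : z ∈ csstHull) :
    csstWord w z ∈ csstHull := by
  induction w with
  | nil => exact hz
  | cons i w ih => exact csstMap_mem_csstHull i ih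

lemma csstMap_eq_zero_of_eq {i j : Fin 3} (hij : i ≠ j) {a b : ℂ} (ha : a ∈ csstHull)
    (hb : b ∈ csstHull) (h : csstMap i a = csstMap j b) : csstMap i a = 0 := by
  obtain ⟨a1, a2, a3, a4⟩ := ha
  obtain ⟨b1, b2, b3, b4⟩ := hb
  have hre := congrArg Complex.re h
  have him := congrArg Complex.im h
  apply Complex.ext <;> fin_cases i <;> fin_cases j <;>
    simp only [Fin.zero_eta, Fin.mk_one, Fin.reduceFinMk, ne_eq, not_true_eq_false,
      csstMap_zero_re, csstMap_zero_im, csstMap_one_re, csstMap_one_im, csstMap_two_re,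
      csstMap_two_im, Complex.zero_re, Complex.zero_im] at hij hre him ⊢ <;> linarith

/-- `z` is an endpoint of the main segment whenever its image under a generator is. -/
lemma eq_one_or_eq_neg_one_of_csstMap {i : Fin 3} {z : ℂ} (hz : z ∈ csstHull)
    (h : csstMap i z = 1 ∨ csstMap i z = -1) : z = 1 ∨ z = -1 := by
  obtain ⟨z1, z2, z3, z4⟩ := hz
  simp only [Complex.ext_iff, Complex.one_re, Complex.one_im, Complex.neg_re,
    Complex.neg_im] at h ⊢
  fin_cases i <;>
    simp only [Fin.zero_eta, Fin.mk_one, Fin.reduceFinMk, csstMap_zero_re, csstMap_zero_im,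
      csstMap_one_re, csstMap_one_im, csstMap_two_re, csstMap_two_im] at h <;>
    rcases h with ⟨h1, h2⟩ | ⟨h1, h2⟩
  all_goals first
    | (exfalso; linarith)
    | exact Or.inl ⟨by linarith, by linarith⟩
    | exact Or.inr ⟨by linarith, by linarith⟩

lemma csstMap_zero_neg_one : csstMap 0 (-1) = -1 := by
  simp [csstMap]; norm_num

lemma csstMap_zero_one : csstMap 0 1 = 0 := by simp [csstMap]

lemma csstMap_one_one : csstMap 1 1 = 1 := by simp [csstMap]; norm_num

lemma csstMap_one_neg_one : csstMap 1 (-1) = 0 := by simp [csstMap]; norm_num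

lemma csstMap_two_neg_one : csstMap 2 (-1) = 0 := by
  simp [csstMap]; ring

namespace IsCSST

variable {T : Set ℂ}

lemma isClosed (hT : IsCSST T) : IsClosed T := hT.2.1.isClosed

lemma csstMap_mem (hT : IsCSST T) (i : Fin 3) {z : ℂ} (hz : z ∈ T) : csstMap i z ∈ T := by
  rw [hT.2.2]
  fin_cases i
  · exact Or.inl (Or.inl ⟨z, hz, rfl⟩)
  · exact Or.inl (Or.inr ⟨z, hz, rfl⟩)
  · exact Or.inr ⟨z, hz, rfl⟩

lemma exists_csstMap_eq (hT : IsCSST T) {z : ℂ} (hz : z ∈ T) :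
    ∃ i, ∃ t ∈ T, csstMap i t = z := by
  rw [hT.2.2] at hz
  rcases hz with (⟨t, ht, h⟩ | ⟨t, ht, h⟩) | ⟨t, ht, h⟩
  exacts [⟨0, t, ht, h⟩, ⟨1, t, ht, h⟩, ⟨2, t, ht, h⟩]

lemma csstWord_mem (hT : IsCSST T) (w : List (Fin 3)) {z : ℂ} (hz : z ∈ T) :
    csstWord w z ∈ T := by
  induction w with
  | nil => exact hz
  | cons i w ih => exact hT.csstMap_mem i ih

lemma exists_csstWord_eq (hT : IsCSST T) (n : ℕ) {z : ℂ} (hz : z ∈ T) :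
    ∃ w : List (Fin 3), w.length = n ∧ ∃ t ∈ T, csstWord w t = z := by
  induction n generalizing z with
  | zero => exact ⟨[], rfl, z, hz, rfl⟩
  | succ n ih =>
    obtain ⟨i, t, ht, rfl⟩ := hT.exists_csstMap_eq hz
    obtain ⟨w, hw, s, hs, rfl⟩ := ih ht
    exact ⟨i :: w, by simp [hw], s, hs, rfl⟩

lemma exists_bound (hT : IsCSST T) (a : ℂ) {ε : ℝ} (hε : 0 < ε) :
    ∃ n : ℕ, ∀ w : List (Fin 3), w.length = n → ∀ t ∈ T,
      dist (csstWord w t) (csstWord w a) < ε := by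
  obtain ⟨M, hM⟩ := hT.2.1.isBounded.subset_closedBall a
  obtain ⟨n, hn⟩ := pow_unbounded_of_one_lt (M / ε) (one_lt_two)
  refine ⟨n, fun w hw t ht => ?_⟩
  rw [dist_csstWord, hw, div_lt_iff₀ (by positivity)]
  rw [div_lt_iff₀ hε] at hn
  have := hM ht
  rw [Metric.mem_closedBall] at this
  linarith [mul_comm ε ((2 : ℝ) ^ n)]

lemma subset_csstHull (hT : IsCSST T) : T ⊆ csstHull := by
  intro z hz
  rw [← isClosed_csstHull.closure_eq, Metric.mem_closure_iff]
  intro ε hε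
  obtain ⟨n, hn⟩ := hT.exists_bound 0 hε
  obtain ⟨w, hw, t, ht, rfl⟩ := hT.exists_csstWord_eq n hz
  exact ⟨_, csstWord_mem_csstHull w (by simp [csstHull]), hn w hw t ht⟩

lemma mem_of_csstMap_eq_self (hT : IsCSST T) {i : Fin 3} {a : ℂ} (ha : csstMap i a = a) :
    a ∈ T := by
  rw [← hT.isClosed.closure_eq, Metric.mem_closure_iff]
  intro ε hε
  obtain ⟨n, hn⟩ := hT.exists_bound a hε
  obtain ⟨t, ht⟩ := hT.1
  have h : ∀ n, csstWord (List.replicate n i) a = a := fun n => by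
    induction n with
    | zero => rfl
    | succ n ih => simp [List.replicate_succ, csstWord, ih, ha]
  refine ⟨_, hT.csstWord_mem (List.replicate n i) ht, ?_⟩
  rw [dist_comm]
  simpa [h] using hn (List.replicate n i) (by simp) t ht

lemma neg_one_mem (hT : IsCSST T) : -1 ∈ T := hT.mem_of_csstMap_eq_self csstMap_zero_neg_one

lemma one_mem (hT : IsCSST T) : 1 ∈ T := hT.mem_of_csstMap_eq_self csstMap_one_one

lemma zero_mem_image (hT : IsCSST T) (i : Fin 3) : 0 ∈ csstMap i '' T := by
  fin_cases i
  · exact ⟨1, hT.one_mem, csstMap_zero_one⟩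
  · exact ⟨-1, hT.neg_one_mem, csstMap_one_neg_one⟩
  · exact ⟨-1, hT.neg_one_mem, csstMap_two_neg_one⟩

lemma zero_mem (hT : IsCSST T) : 0 ∈ T := by
  obtain ⟨t, ht, h⟩ := hT.zero_mem_image 0
  exact h ▸ hT.csstMap_mem 0 ht

lemma isPreconnected (hT : IsCSST T) : IsPreconnected T := by
  refine isPreconnected_of_forall_constant fun f hf => ?_
  have hg : Continuous fun b : Bool => if b then (1 : ℝ) else 0 := continuous_of_discreteTopology
  have hu := hT.2.1.uniformContinuousOn_of_continuous (hg.comp_continuousOn hf)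
  obtain ⟨ε, hε, hfε⟩ := Metric.uniformContinuousOn_iff.1 hu 1 one_pos
  obtain ⟨n, hn⟩ := hT.exists_bound 0 hε
  have step : ∀ m k : ℕ, k + m = n → ∀ w : List (Fin 3), w.length = k →
      ∀ t ∈ T, f (csstWord w t) = f (csstWord w 0) := by
    intro m
    induction m with
    | zero =>
      rintro k rfl w hw t ht
      by_contra hne
      have := hfε _ (hT.csstWord_mem w ht) _ (hT.csstWord_mem w hT.zero_mem) (hn w hw t ht)
      revert hne this
      cases h1 : f (csstWord w t) <;> cases h2 : f (csstWord w 0) <;> simp [h1, h2]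
    | succ m ih =>
      intro k hk w hw t ht
      have happ : ∀ (w : List (Fin 3)) i z, csstWord (w ++ [i]) z = csstWord w (csstMap i z) := by
        intro w i z
        induction w with
        | nil => rfl
        | cons j w ihw => simp only [List.cons_append, csstWord, Function.comp_apply, ihw]
      obtain ⟨i, s, hs, rfl⟩ := hT.exists_csstMap_eq ht
      obtain ⟨c, hc, hc0⟩ := hT.zero_mem_image i
      have hi := ih (k + 1) (by omega) (w ++ [i]) (by simp [hw])
      have h1 := hi s hs
      have h2 := hi c hc
      rw [happ] at h1 h2
      rw [h1, ← h2, hc0]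
  intro x hx y hy
  have h := step n 0 (by simp) [] rfl
  exact (h x hx).trans (h y hy).symm

lemma eq_of_mem_image (hT : IsCSST T) {i j : Fin 3} {z : ℂ} (hz : z ≠ 0)
    (hi : z ∈ csstMap i '' T) (hj : z ∈ csstMap j '' T) : i = j := by
  obtain ⟨a, ha, rfl⟩ := hi
  obtain ⟨b, hb, h⟩ := hj
  by_contra hij
  exact hz (csstMap_eq_zero_of_eq hij (hT.subset_csstHull ha) (hT.subset_csstHull hb) h.symm)

lemma csstWord_cons_image_subset (hT : IsCSST T) (i : Fin 3) (w : List (Fin 3)) :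
    csstWord (i :: w) '' T ⊆ csstMap i '' T := by
  rintro _ ⟨t, ht, rfl⟩
  exact ⟨_, hT.csstWord_mem w ht, rfl⟩

lemma accPt_zero (hT : IsCSST T) (i : Fin 3) : AccPt 0 (Filter.principal (csstMap i '' T)) := by
  have hnt : (csstMap i '' T).Nontrivial :=
    (Set.nontrivial_of_mem_mem_ne hT.one_mem hT.neg_one_mem (by norm_num)).image
      (csstMap_injective i)
  exact (hT.isPreconnected.image _ (continuous_csstMap i).continuousOn).preperfect_of_nontrivial
    hnt 0 (hT.zero_mem_image i)

lemma eq_nil_of_mem_nhdsWithin (hT : IsCSST T) {w : List (Fin 3)}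
    (h : csstWord w '' T ∈ nhdsWithin 0 T) : w = [] := by
  rcases w with _ | ⟨j, w⟩
  · rfl
  obtain ⟨i, hij⟩ := exists_ne j
  obtain ⟨u, hu, h0, hsub⟩ := mem_nhdsWithin.1 h
  obtain ⟨y, ⟨hyu, hyi⟩, hy0⟩ := accPt_iff_nhds.1 (hT.accPt_zero i) u (hu.mem_nhds h0)
  have hyT : y ∈ T := by
    obtain ⟨t, ht, rfl⟩ := hyi
    exact hT.csstMap_mem i ht
  exact absurd (hT.eq_of_mem_image hy0 hyi
    (hT.csstWord_cons_image_subset j w (hsub ⟨hyu, hyT⟩))) hij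

lemma eq_nil_of_csstWord_image_eq (hT : IsCSST T) {w : List (Fin 3)}
    (h : csstWord w '' T = T) : w = [] :=
  hT.eq_nil_of_mem_nhdsWithin
    (h.symm.subst (motive := (· ∈ nhdsWithin 0 T)) self_mem_nhdsWithin)

lemma connectedComponentIn_mem_nhdsWithin (hT : IsCSST T) {V : Set ℂ} (hV : IsClosed V) {x : ℂ}
    (hx : x ∈ T \ V) : connectedComponentIn (T \ V) x ∈ nhdsWithin x T := by
  obtain ⟨ε, hε, hball⟩ := Metric.isOpen_iff.1 hV.isOpen_compl x hx.2
  obtain ⟨n, hn⟩ := hT.exists_bound x (half_pos hε)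
  have hfin : {w : List (Fin 3) | w.length = n ∧ x ∉ csstWord w '' T}.Finite :=
    (List.finite_length_eq (Fin 3) n).subset fun w hw => hw.1
  have hK : IsClosed (⋃ w ∈ {w : List (Fin 3) | w.length = n ∧ x ∉ csstWord w '' T},
      csstWord w '' T) :=
    hfin.isClosed_biUnion fun w _ => (hT.2.1.image (continuous_csstWord w)).isClosed
  refine mem_nhdsWithin.2 ⟨_, hK.isOpen_compl, ?_, ?_⟩
  · simp only [Set.mem_compl_iff, Set.mem_iUnion₂, not_exists]
    exact fun w hw => hw.2
  · rintro y ⟨hyK, hyT⟩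
    obtain ⟨w, hw, t, ht, rfl⟩ := hT.exists_csstWord_eq n hyT
    have hxw : x ∈ csstWord w '' T := by
      by_contra hxw
      exact hyK (Set.mem_biUnion (show w ∈ {w : List (Fin 3) | _} from ⟨hw, hxw⟩) ⟨t, ht, rfl⟩)
    refine (hT.isPreconnected.image _
      (continuous_csstWord w).continuousOn).subset_connectedComponentIn hxw ?_ ⟨t, ht, rfl⟩
    rintro _ ⟨s, hs, rfl⟩
    refine ⟨hT.csstWord_mem w hs, hball ?_⟩
    obtain ⟨r, hr, hrx⟩ := hxw
    have h1 := hn w hw s hs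
    have h2 := hn w hw r hr
    rw [hrx, dist_comm] at h2
    exact Metric.mem_ball.2 ((dist_triangle _ _ _).trans_lt (by linarith))

lemma connectedComponentIn_eq_of_mem_closure (hT : IsCSST T) {V : Set ℂ} (hV : IsClosed V)
    {p q : ℂ} (hq : q ∈ T \ V) (h : q ∈ closure (connectedComponentIn (T \ V) p)) :
    connectedComponentIn (T \ V) p = connectedComponentIn (T \ V) q := by
  obtain ⟨u, hu, hqu, hsub⟩ := mem_nhdsWithin.1 (hT.connectedComponentIn_mem_nhdsWithin hV hq)
  obtain ⟨y, hyu, hyp⟩ := mem_closure_iff.1 h u hu hqu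
  have hyT : y ∈ T := (connectedComponentIn_subset _ _ hyp).1
  rw [connectedComponentIn_eq hyp, connectedComponentIn_eq (hsub ⟨hyu, hyT⟩)]

lemma eq_of_isTileOf_self (hT : IsCSST T) {V X : Set ℂ} (hV : IsClosed V) (hTV : IsTileOf T V T)
    (hX : IsTileOf T V X) : X = T := by
  obtain ⟨p, -, hp⟩ := hTV
  obtain ⟨q, hq, rfl⟩ := hX
  rw [← hT.connectedComponentIn_eq_of_mem_closure hV hq (hp ▸ hq.1), ← hp]

lemma not_isTileOf_self (hT : IsCSST T) {V : Set ℂ} {p : ℂ} (hp : p ∈ V)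
    (hbp : IsBranchPointIn T p) : ¬ IsTileOf T V T := by
  rintro ⟨q, hq, hTq⟩
  have hqp : q ∈ T \ {p} := ⟨hq.1, fun h => hq.2 (h ▸ hp)⟩
  have hself : IsTileOf T {p} T := by
    refine ⟨q, hqp, Set.Subset.antisymm ?_ ?_⟩
    · exact hTq.subset.trans (closure_mono (connectedComponentIn_mono _
        (Set.sdiff_subset_sdiff_right (Set.singleton_subset_iff.2 hp))))
    · exact hT.isClosed.closure_subset_iff.2
        ((connectedComponentIn_subset _ _).trans Set.sdiff_subset)
  obtain ⟨B₁, B₂, -, h₁, h₂, -, h₁₂, -, -⟩ := hbp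
  exact h₁₂ ((hT.eq_of_isTileOf_self isClosed_singleton hself h₁).trans
    (hT.eq_of_isTileOf_self isClosed_singleton hself h₂).symm)

/-- Components of `T` with `0` removed stay inside one of the three first-level tiles. -/
lemma connectedComponentIn_subset_image (hT : IsCSST T) {V : Set ℂ} (h0 : (0 : ℂ) ∈ V)
    {i : Fin 3} {q : ℂ} (hq : q ∈ T \ V) (hqi : q ∈ csstMap i '' T) :
    connectedComponentIn (T \ V) q ⊆ csstMap i '' T := by
  have hsub : connectedComponentIn (T \ V) q ⊆ T \ V := connectedComponentIn_subset _ _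
  have hclosed : ∀ j, IsClosed (csstMap j '' T) :=
    fun j => (hT.2.1.image (continuous_csstMap j)).isClosed
  have hne : ∀ z ∈ T \ V, z ≠ 0 := fun z hz h => hz.2 (h ▸ h0)
  have hclosed' : IsClosed (⋃ j ∈ {j | j ≠ i}, csstMap j '' T) :=
    (Set.toFinite _).isClosed_biUnion fun j _ => hclosed j
  have hcover : connectedComponentIn (T \ V) q ⊆
      csstMap i '' T ∪ ⋃ j ∈ {j | j ≠ i}, csstMap j '' T := by
    intro z hz
    obtain ⟨j, t, ht, rfl⟩ := hT.exists_csstMap_eq (hsub hz).1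
    by_cases hj : j = i
    · exact Or.inl ⟨t, ht, by rw [hj]⟩
    · exact Or.inr (Set.mem_biUnion hj ⟨t, ht, rfl⟩)
  have hdisj : ∀ z ∈ T \ V, z ∈ csstMap i '' T → z ∉ ⋃ j ∈ {j | j ≠ i}, csstMap j '' T := by
    intro z hz hzi hzj
    obtain ⟨j, hj, hzj⟩ := Set.mem_iUnion₂.1 hzj
    exact hj (hT.eq_of_mem_image (hne z hz) hzj hzi)
  rcases isPreconnected_iff_subset_of_disjoint_closed.1 isPreconnected_connectedComponentIn _ _
    (hclosed i) hclosed' hcover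
    (Set.eq_empty_of_forall_notMem fun z hz => hdisj z (hsub hz.1) hz.2.1 hz.2.2) with h | h
  · exact h
  · exact absurd (h (mem_connectedComponentIn hq)) (hdisj q hq hqi)

/-- When `0 ∈ V`, the tiles inside the `i`-th first-level tile are rescaled tiles of the
decomposition induced by the preimage of `V`. -/
lemma csstMap_image_closure (hT : IsCSST T) {V : Set ℂ} (h0 : (0 : ℂ) ∈ V) {i : Fin 3} {q : ℂ}
    (hq : q ∈ T) (hqV : csstMap i q ∉ V) :
    csstMap i '' closure (connectedComponentIn (T \ (T ∩ csstMap i ⁻¹' V)) q) =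
      closure (connectedComponentIn (T \ V) (csstMap i q)) := by
  have hmem : csstMap i q ∈ T \ V := ⟨hT.csstMap_mem i hq, hqV⟩
  have himage : csstMap i '' (T \ (T ∩ csstMap i ⁻¹' V)) = csstMap i '' T \ V := by
    ext z
    constructor
    · rintro ⟨t, ⟨ht, htV⟩, rfl⟩
      exact ⟨⟨t, ht, rfl⟩, fun h => htV ⟨ht, h⟩⟩
    · rintro ⟨⟨t, ht, rfl⟩, hV⟩
      exact ⟨t, ⟨ht, fun h => hV h.2⟩, rfl⟩
  rw [← coe_csstHomeo, Homeomorph.image_closure, Homeomorph.image_connectedComponentIn _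
    (show q ∈ T \ _ from ⟨hq, fun h => hqV h.2⟩), coe_csstHomeo, himage]
  congr 1
  refine Set.Subset.antisymm (connectedComponentIn_mono _ ?_) ?_
  · rintro _ ⟨⟨t, ht, rfl⟩, h⟩
    exact ⟨hT.csstMap_mem i ht, h⟩
  · refine isPreconnected_connectedComponentIn.subset_connectedComponentIn
      (mem_connectedComponentIn hmem) fun z hz => ⟨?_, (connectedComponentIn_subset _ _ hz).2⟩
    exact hT.connectedComponentIn_subset_image h0 hmem ⟨q, hq, rfl⟩ hz

/-- If the image of the tile through `q` under a generator is `g_w(T)`, then the tile itself is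
`g_{w'}(T)` where `w'` is `w` without its first letter. -/
lemma exists_of_csstMap_image_eq (hT : IsCSST T) {i : Fin 3} {X : Set ℂ} {q : ℂ} (hXT : X ⊆ T)
    (hq : q ∈ X) (hq0 : csstMap i q ≠ 0) {w : List (Fin 3)}
    (h : csstMap i '' X = csstWord w '' T) : ∃ w', w = i :: w' ∧ X = csstWord w' '' T := by
  have hqT : csstMap i q ∈ csstWord w '' T := h ▸ ⟨q, hq, rfl⟩
  have hsub : csstWord w '' T ⊆ csstMap i '' T := h ▸ Set.image_mono hXT
  rcases w with _ | ⟨j, w⟩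
  · obtain ⟨j, hj⟩ := exists_ne i
    obtain ⟨y, ⟨-, t, ht, rfl⟩, hy0⟩ :=
      accPt_iff_nhds.1 (hT.accPt_zero j) Set.univ Filter.univ_mem
    exact absurd (hT.eq_of_mem_image hy0 ⟨t, ht, rfl⟩
      (hsub ⟨_, hT.csstMap_mem j ht, rfl⟩)) hj
  · obtain rfl := hT.eq_of_mem_image hq0 (hsub hqT) (hT.csstWord_cons_image_subset j w hqT)
    refine ⟨w, rfl, (csstMap_injective i).image_injective ?_⟩
    rw [h, ← Set.image_comp]
    rfl

lemma ncard_preimage_lt (hT : IsCSST T) {V : Set ℂ} (hV : V.Finite) (h0 : (0 : ℂ) ∈ V)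
    (i : Fin 3) :
    ((T ∩ csstMap i ⁻¹' V) \ {1, -1}).ncard < (V \ {1, -1}).ncard := by
  have h0' : (0 : ℂ) ∈ V \ {1, -1} := ⟨h0, by simp⟩
  have hmaps : ∀ z ∈ (T ∩ csstMap i ⁻¹' V) \ {1, -1}, csstMap i z ∈ (V \ {1, -1}) \ {0} := by
    rintro z ⟨⟨hzT, hzV⟩, hz⟩
    refine ⟨⟨hzV, fun h => hz (eq_one_or_eq_neg_one_of_csstMap (hT.subset_csstHull hzT) h)⟩, ?_⟩
    intro h
    refine hz ?_
    have key : csstMap i 1 = 0 ∨ csstMap i (-1) = 0 := by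
      fin_cases i
      exacts [Or.inl csstMap_zero_one, Or.inr csstMap_one_neg_one, Or.inr csstMap_two_neg_one]
    exact key.imp (fun k => csstMap_injective i (h.trans k.symm))
      (fun k => csstMap_injective i (h.trans k.symm))
  exact (Set.ncard_le_ncard_of_injOn _ hmaps (csstMap_injective i).injOn
    (hV.sdiff.sdiff)).trans_lt (Set.ncard_sdiff_singleton_lt_of_mem h0' hV.sdiff)

theorem length_le_ncard (hT : IsCSST T) {V : Set ℂ} (hV : V.Finite)
    (htiles : ∀ X, IsTileOf T V X → ∃ w, X = csstWord w '' T)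
    {X : Set ℂ} (hX : IsTileOf T V X) {w : List (Fin 3)} (hw : X = csstWord w '' T) :
    w.length ≤ (V \ {1, -1}).ncard := by
  induction hn : (V \ {1, -1}).ncard using Nat.strong_induction_on generalizing V X w with
  | h n ih =>
    by_cases h0 : (0 : ℂ) ∈ V
    · have hne : ∀ z, z ∉ V → z ≠ 0 := fun z hz h => hz (h ▸ h0)
      have hsubT : ∀ F q, closure (connectedComponentIn (T \ F) q) ⊆ T := fun F q =>
        hT.isClosed.closure_subset_iff.2 ((connectedComponentIn_subset _ _).trans Set.sdiff_subset)
      obtain ⟨_, ⟨hqT, hqV⟩, rfl⟩ := hX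
      obtain ⟨i, q, hq, rfl⟩ := hT.exists_csstMap_eq hqT
      have hq' : q ∈ T \ (T ∩ csstMap i ⁻¹' V) := ⟨hq, fun h => hqV h.2⟩
      rw [← hT.csstMap_image_closure h0 hq hqV] at hw
      obtain ⟨w', rfl, hw'⟩ := hT.exists_of_csstMap_image_eq (hsubT _ _)
        (subset_closure (mem_connectedComponentIn hq')) (hne _ hqV) hw
      have hlt := hn ▸ hT.ncard_preimage_lt hV h0 i
      have hfin : (T ∩ csstMap i ⁻¹' V).Finite :=
        (hV.preimage (csstMap_injective i).injOn).inter_of_right T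
      have := ih _ hlt hfin ?_ ⟨q, hq', rfl⟩ hw' rfl
      · rw [List.length_cons]
        omega
      · rintro _ ⟨p, hp, rfl⟩
        have hpV : csstMap i p ∉ V := fun h => hp.2 ⟨hp.1, h⟩
        obtain ⟨v, hv⟩ := htiles _ ⟨csstMap i p, ⟨hT.csstMap_mem i hp.1, hpV⟩, rfl⟩
        rw [← hT.csstMap_image_closure h0 hp.1 hpV] at hv
        obtain ⟨v', -, hv'⟩ := hT.exists_of_csstMap_image_eq (hsubT _ _)
          (subset_closure (mem_connectedComponentIn hp)) (hne _ hpV) hv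
        exact ⟨v', hv'⟩
    · have h0T : (0 : ℂ) ∈ T \ V := ⟨hT.zero_mem, h0⟩
      obtain ⟨v, hv⟩ := htiles _ ⟨0, h0T, rfl⟩
      obtain rfl : v = [] := hT.eq_nil_of_mem_nhdsWithin (hv ▸ Filter.mem_of_superset
        (hT.connectedComponentIn_mem_nhdsWithin hV.isClosed h0T) subset_closure)
      have hTV : IsTileOf T V T := ⟨0, h0T, by rw [hv]; exact (Set.image_id T).symm⟩
      rw [hT.eq_of_isTileOf_self hV.isClosed hTV hX] at hw
      simp [hT.eq_nil_of_csstWord_image_eq hw.symm]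

end IsCSST

theorem stmt19 (T : Set ℂ) (hT : IsCSST T)
    (V : Set ℂ) (hVsub : V ⊆ T) (hVfin : V.Finite)
    (hVbp : ∀ p ∈ V, IsBranchPointIn T p)
    -- every tile of the decomposition induced by `V` is of the form `g_w(T)`
    (htiles : ∀ X : Set ℂ, IsTileOf T V X → ∃ w : List (Fin 3), X = csstWord w '' T) :
    ∀ X : Set ℂ, IsTileOf T V X → ∀ w : List (Fin 3), X = csstWord w '' T →
      w.length ≤ V.ncard ∧ (V.Nonempty → 1 ≤ w.length) := by
  intro X hX w hw
  refine ⟨(hT.length_le_ncard hVfin htiles hX hw).trans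
    (Set.ncard_le_ncard Set.sdiff_subset hVfin), fun ⟨p, hp⟩ => ?_⟩
  rw [Nat.one_le_iff_ne_zero, ne_eq, List.length_eq_zero_iff]
  rintro rfl
  refine hT.not_isTileOf_self hp (hVbp p hp) ?_
  rwa [hw, csstWord, Set.image_id] at hX
end
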